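/- arXiv:2310.14462 — 7 statements merged into one kernel-verified Lean document; each statement's English description precedes it below -/
import Mathlib

section
/- Let G be a finite subgroup of Aut(𝔽_q(x)/𝔽_q) consisting of affine automorphisms, and set x_G = ∏_{σ∈G} σ(x) ∈ 𝔽_q(x). Then x_G is a polynomial in x of degree |G|, and the fixed field 𝔽_q(x)^G = { u ∈ 𝔽_q(x) : σ(u) = u for all σ ∈ G } equals the subfield 𝔽_q(x_G) of 𝔽_q(x) generated by x_G over 𝔽_q. -/
open Polynomial in
/-- A product of nonzero affine polynomials `a i * X + b i` has degree the number of factors. -/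
theorem natDegree_prod_C_mul_X_add_C {K ι : Type*} [Field K] [Fintype ι] (a b : ι → K)
    (ha : ∀ i, a i ≠ 0) : (∏ i, (C (a i) * X + C (b i))).natDegree = Fintype.card ι := by
  have hne (i : ι) : C (a i) * X + C (b i) ≠ 0 := fun h ↦ by
    simpa [h] using natDegree_linear (b := b i) (ha i)
  rw [natDegree_prod _ _ fun i _ ↦ hne i]
  simp [natDegree_linear (ha _)]

/-- `K(X)` has degree `n` over the subfield generated by a polynomial of degree `n`. -/
theorem RatFunc.finrank_adjoin_algebraMap {K : Type*} [Field K] (P : Polynomial K) :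
    Module.finrank (IntermediateField.adjoin K {algebraMap (Polynomial K) (RatFunc K) P})
      (RatFunc K) = P.natDegree := by
  simp [RatFunc.finrank_eq_max_natDegree]

/-- The product of the conjugates of `x` under a finite group is fixed by that group. -/
theorem IntermediateField.prod_apply_mem_fixedField {K L : Type*} [Field K] [Field L]
    [Algebra K L] (G : Subgroup (L ≃ₐ[K] L)) [Fintype G] (x : L) :
    ∏ σ : G, (σ : L ≃ₐ[K] L) x ∈ IntermediateField.fixedField G := by
  rw [IntermediateField.mem_fixedField_iff]
  intro τ hτ
  rw [map_prod]
  exact Fintype.prod_equiv (Equiv.mulLeft ⟨τ, hτ⟩) _ _ fun σ ↦ rfl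


/-- **Fixed field of a finite group of affine automorphisms of a rational function field.**
Let `G` be a finite subgroup of `Aut(𝔽_q(x)/𝔽_q)` consisting of affine automorphisms
(`σ(x) = a·x + b` with `a ≠ 0`), and set `x_G = ∏_{σ ∈ G} σ(x)`.  Then `x_G` is a polynomial
in `x` of degree `|G|` and the fixed field of `G` equals the subfield `𝔽_q(x_G)`. -/
theorem fixedField_of_affine_subgroup_eq_adjoin_prod
    (Fq : Type*) [Field Fq] [Fintype Fq]
    (G : Subgroup (RatFunc Fq ≃ₐ[Fq] RatFunc Fq)) [Fintype G]
    (haff : ∀ σ ∈ G, ∃ a b : Fq, a ≠ 0 ∧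
      σ RatFunc.X = RatFunc.C a * RatFunc.X + RatFunc.C b) :
    (∃ P : Polynomial Fq, P.natDegree = Fintype.card G ∧
      algebraMap (Polynomial Fq) (RatFunc Fq) P =
        ∏ σ : G, (σ : RatFunc Fq ≃ₐ[Fq] RatFunc Fq) RatFunc.X) ∧
    IntermediateField.fixedField G =
      IntermediateField.adjoin Fq
        {∏ σ : G, (σ : RatFunc Fq ≃ₐ[Fq] RatFunc Fq) RatFunc.X} := by
  choose a b ha hab using fun σ : G ↦ haff σ σ.2
  let P : Polynomial Fq := ∏ σ : G, (Polynomial.C (a σ) * Polynomial.X + Polynomial.C (b σ))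
  have hdeg : P.natDegree = Fintype.card G := natDegree_prod_C_mul_X_add_C a b ha
  have hP : algebraMap (Polynomial Fq) (RatFunc Fq) P =
      ∏ σ : G, (σ : RatFunc Fq ≃ₐ[Fq] RatFunc Fq) RatFunc.X := by
    simp [P, map_prod, hab]
  have hrank := RatFunc.finrank_adjoin_algebraMap P
  rw [hP, hdeg] at hrank
  have : FiniteDimensional (IntermediateField.adjoin Fq
      {∏ σ : G, (σ : RatFunc Fq ≃ₐ[Fq] RatFunc Fq) RatFunc.X}) (RatFunc Fq) :=
    Module.finite_of_finrank_pos (hrank ▸ Fintype.card_pos)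
  refine ⟨⟨P, hdeg, hP⟩, (IntermediateField.eq_of_le_of_finrank_eq' ?_ ?_).symm⟩
  · rw [IntermediateField.adjoin_simple_le_iff]
    exact IntermediateField.prod_apply_mem_fixedField G _
  · rw [hrank]
    exact (FixedPoints.finrank_eq_card G (RatFunc Fq)).symm
end

section
/- Let 𝔽_q have characteristic p, let W be an 𝔽_p-linear subspace of 𝔽_q and let α ∈ 𝔽_q \ W; set W' = W ⊕ 𝔽_p·α. Define ℓ_W(X) = ∏_{w∈W}(X − w) and ℓ_{W'}(X) = ∏_{w∈W'}(X − w) in 𝔽_q[X]. Then ℓ_{W'}(X) = ℓ_W(X)^p − ℓ_W(α)^{p−1} · ℓ_W(X). -/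
open Polynomial

theorem eval_prod_X_sub_C_eq_zero {R : Type*} [CommRing R] {s : Finset R} {x : R} (hx : x ∈ s) :
    (∏ w ∈ s, (X - C w)).eval x = 0 := by
  rw [eval_prod]
  exact Finset.prod_eq_zero hx (by simp)

/-- A monic polynomial that vanishes on a finite set of cardinality its degree is the product of
the corresponding linear factors. -/
theorem prod_X_sub_C_eq_of_monic {R : Type*} [CommRing R] [IsDomain R] (s : Finset R)
    {f : R[X]} (hf : f.Monic) (hdeg : f.natDegree = s.card) (hs : ∀ x ∈ s, f.eval x = 0) :
    ∏ w ∈ s, (X - C w) = f := by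
  have hm : (∏ w ∈ s, (X - C w)).Monic := monic_prod_X_sub_C _ _
  have hd : (∏ w ∈ s, (X - C w)).natDegree = s.card := natDegree_finsetProd_X_sub_C_eq_card s id
  refine eq_of_degree_le_of_eval_finset_eq s ?_ ?_ ?_ fun x hx ↦ ?_
  · rw [degree_eq_natDegree hm.ne_zero, hd]
  · rw [degree_eq_natDegree hm.ne_zero, hd, degree_eq_natDegree hf.ne_zero, hdeg]
  · rw [hm.leadingCoeff, hf.leadingCoeff]
  · rw [hs x hx, eval_prod_X_sub_C_eq_zero hx]

theorem eval_add_prod_X_sub_C_of_mem {R : Type*} [CommRing R] (H : AddSubgroup R)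
    (s : Finset R) (hs : ∀ x, x ∈ s ↔ x ∈ H) {w : R} (hw : w ∈ H) (a : R) :
    (∏ v ∈ s, (X - C v)).eval (w + a) = (∏ v ∈ s, (X - C v)).eval a := by
  simp only [eval_prod, eval_sub, eval_X, eval_C]
  refine Finset.prod_equiv (Equiv.subRight w) (fun v ↦ ?_) fun v _ ↦ ?_
  · simp only [hs, Equiv.subRight_apply]
    exact ⟨fun h ↦ H.sub_mem h hw, fun h ↦ by simpa using H.add_mem h hw⟩
  · simp only [Equiv.subRight_apply]
    ring

/-- The polynomial whose roots are the elements of a finite additive subgroup is additive. -/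
theorem eval_add_prod_X_sub_C {R : Type*} [CommRing R] [IsDomain R] (H : AddSubgroup R)
    (s : Finset R) (hs : ∀ x, x ∈ s ↔ x ∈ H) (a b : R) :
    (∏ v ∈ s, (X - C v)).eval (a + b) =
      (∏ v ∈ s, (X - C v)).eval a + (∏ v ∈ s, (X - C v)).eval b := by
  have hm : (∏ w ∈ s, (X - C w)).Monic := monic_prod_X_sub_C _ _
  have hd : (∏ w ∈ s, (X - C w)).natDegree = s.card := natDegree_finsetProd_X_sub_C_eq_card s id
  have h : ∏ v ∈ s, (X - C v) = (∏ v ∈ s, (X - C v)).comp (X + C b) -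
      C ((∏ v ∈ s, (X - C v)).eval b) := by
    have hpos : 0 < s.card := Finset.card_pos.mpr ⟨0, (hs 0).mpr H.zero_mem⟩
    have hdc : ((∏ v ∈ s, (X - C v)).comp (X + C b)).natDegree = s.card := by
      rw [natDegree_comp, natDegree_X_add_C, mul_one, hd]
    refine prod_X_sub_C_eq_of_monic s ((hm.comp_X_add_C b).sub_of_left ?_) ?_ fun x hx ↦ ?_
    · refine degree_C_le.trans_lt (natDegree_pos_iff_degree_pos.mp ?_)
      rwa [hdc]
    · rw [natDegree_sub_C, hdc]
    · simp only [eval_sub, eval_comp, eval_add, eval_X, eval_C]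
      rw [eval_add_prod_X_sub_C_of_mem H s hs ((hs x).mp hx), sub_self]
  have h' := congrArg (eval a) h
  simp only [eval_sub, eval_comp, eval_add, eval_X, eval_C] at h'
  exact (eq_sub_iff_add_eq.mp h').symm

theorem natCard_sup_span_singleton {K V : Type*} [Field K] [AddCommGroup V] [Module K V]
    [Module.Finite K V] (W : Submodule K V) {x : V} (hx : x ∉ W) :
    Nat.card (W ⊔ Submodule.span K {x} : Submodule K V) = Nat.card K * Nat.card W := by
  have hx0 : x ≠ 0 := fun h ↦ hx (h ▸ W.zero_mem)
  have hinf : W ⊓ Submodule.span K {x} = ⊥ :=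
    disjoint_iff.mp ((Submodule.disjoint_span_singleton' hx0).mpr hx)
  have h := Submodule.finrank_sup_add_finrank_inf_eq W (Submodule.span K {x})
  rw [hinf, finrank_bot, finrank_span_singleton hx0, add_zero] at h
  rw [Module.natCard_eq_pow_finrank (K := K), Module.natCard_eq_pow_finrank (K := K) (V := W), h,
    pow_succ, mul_comm]

/-- **Recursion for linearized (subspace) polynomials.**
Let `𝔽_q` have characteristic `p`, let `W` be an `𝔽_p`-subspace of `𝔽_q` and
`α ∈ 𝔽_q \ W`; set `W' = W ⊕ 𝔽_p·α`.  With `ℓ_S(X) = ∏_{w ∈ S}(X - w)`, we have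
`ℓ_{W'}(X) = ℓ_W(X)^p - ℓ_W(α)^{p-1}·ℓ_W(X)`. -/
theorem subspace_polynomial_recursion
    (p : ℕ) [Fact p.Prime] (Fq : Type*) [Field Fq] [Fintype Fq] [CharP Fq p]
    [Algebra (ZMod p) Fq]
    (W : Submodule (ZMod p) Fq) (α : Fq) (hα : α ∉ W) :
    (∏ w ∈ (Set.toFinite
        ((W ⊔ Submodule.span (ZMod p) {α} : Submodule (ZMod p) Fq) : Set Fq)).toFinset,
      (X - C w)) =
    (∏ w ∈ (Set.toFinite (W : Set Fq)).toFinset, (X - C w)) ^ p -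
      C ((Polynomial.eval α
            (∏ w ∈ (Set.toFinite (W : Set Fq)).toFinset, (X - C w))) ^ (p - 1)) *
        ∏ w ∈ (Set.toFinite (W : Set Fq)).toFinset, (X - C w) := by
  set s := (Set.toFinite (W : Set Fq)).toFinset with hsdef
  have hs : ∀ x, x ∈ s ↔ x ∈ W.toAddSubgroup := fun x ↦ by simp [hsdef]
  have hp : p.Prime := Fact.out
  have hm : (∏ w ∈ s, (X - C w)).Monic := monic_prod_X_sub_C _ _
  have hd : (∏ w ∈ s, (X - C w)).natDegree = s.card := natDegree_finsetProd_X_sub_C_eq_card s id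
  have hadd := eval_add_prod_X_sub_C W.toAddSubgroup s hs
  have hroot : ∀ x ∈ s, (∏ v ∈ s, (X - C v)).eval x = 0 := fun x hx ↦
    eval_prod_X_sub_C_eq_zero hx
  have hpos : 0 < s.card := Finset.card_pos.mpr ⟨0, (hs 0).mpr W.zero_mem⟩
  generalize (∏ w ∈ s, (X - C w)) = L at hm hd hadd hroot ⊢
  have hsmul (c : ZMod p) (x : Fq) : L.eval (c • x) = c • L.eval x :=
    ZMod.map_smul (AddMonoidHom.mk' (fun x ↦ L.eval x) hadd) c x
  have hlt : (C (L.eval α ^ (p - 1)) * L).natDegree < (L ^ p).natDegree := by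
    rw [hm.natDegree_pow, hd]
    refine (natDegree_C_mul_le _ _).trans_lt ?_
    rw [hd]
    exact lt_mul_of_one_lt_left hpos hp.one_lt
  refine prod_X_sub_C_eq_of_monic _ ((hm.pow p).sub_of_left (degree_lt_degree hlt)) ?_ ?_
  · rw [natDegree_sub_eq_left_of_natDegree_lt hlt, hm.natDegree_pow, hd, hsdef,
      ← Nat.card_eq_card_finite_toFinset, ← Nat.card_eq_card_finite_toFinset]
    exact ((natCard_sup_span_singleton W hα).trans (by rw [Nat.card_zmod]; rfl)).symm
  · intro x hx
    rw [Set.Finite.mem_toFinset, SetLike.mem_coe, Submodule.mem_sup] at hx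
    obtain ⟨w, hw, y, hy, rfl⟩ := hx
    obtain ⟨c, rfl⟩ := Submodule.mem_span_singleton.mp hy
    simp only [eval_sub, eval_pow, eval_mul, eval_C]
    rw [hadd, hroot w ((hs w).mpr hw), zero_add, hsmul, _root_.smul_pow, ZMod.pow_card,
      mul_smul_comm, pow_sub_one_mul hp.ne_zero, sub_self]
end

section
/- Let 𝔽_q have characteristic p, let r be a positive integer with p^r ≤ q, and let {0} = W_0 ⊊ W_1 ⊊ ⋯ ⊊ W_r be an ascending chain of 𝔽_p-linear subspaces of 𝔽_q with dim_{𝔽_p} W_i = i. Set ℓ_i(X) = ∏_{w∈W_i}(X − w) ∈ 𝔽_q[X], a polynomial of degree p^i. Then the set { ℓ_0(X)^{e_0} ℓ_1(X)^{e_1} ⋯ ℓ_{r−1}(X)^{e_{r−1}} : (e_0,…,e_{r−1}) ∈ {0,1,…,p−1}^r } is an 𝔽_q-basis of the vector space 𝔽_q[X]_{<p^r} of polynomials over 𝔽_q of degree less than p^r. -/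
open Polynomial

namespace Polynomial

/-- A family of polynomials over a field whose degrees enumerate `0, …, N - 1` is linearly
independent and spans the space of polynomials of degree less than `N`. -/
theorem linearIndependent_and_span_eq_degreeLT_of_degree_eq {K ι : Type*} [Field K] {N : ℕ}
    (σ : ι ≃ Fin N) (v : ι → K[X]) (hv : ∀ i, (v i).degree = ((σ i : ℕ) : WithBot ℕ)) :
    LinearIndependent K v ∧ Submodule.span K (Set.range v) = degreeLT K N := by
  let S : Sequence K :=
    { elems' := fun n => if h : n < N then v (σ.symm ⟨n, h⟩) else X ^ n
      degree_eq' := fun n => by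
        by_cases h : n < N <;> simp [h, hv] }
  have hS : v = fun i => S (σ i : ℕ) := by
    funext i
    change v i = dite _ _ _
    simp
  constructor
  · rw [hS]
    exact S.linearIndependent.comp _ (Fin.val_injective.comp σ.injective)
  · rw [← S.span_degreeLT fun i _ => (leadingCoeff_ne_zero.mpr (S.ne_zero i)).isUnit]
    congr 1
    rw [hS]
    ext f
    constructor
    · rintro ⟨i, rfl⟩
      exact ⟨_, (σ i).isLt, rfl⟩
    · rintro ⟨n, hn, rfl⟩
      exact ⟨σ.symm ⟨n, hn⟩, by simp⟩

end Polynomial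

/-- **Lin–Chung–Han basis of `𝔽_q[X]_{<p^r}` from a chain of `𝔽_p`-subspaces.**
Let `𝔽_q` have characteristic `p`, `p^r ≤ q`, and let `0 = W_0 ⊊ W_1 ⊊ ⋯ ⊊ W_r` be a
chain of `𝔽_p`-subspaces of `𝔽_q` with `dim W_i = i`.  With `ℓ_i(X) = ∏_{w ∈ W_i}(X - w)`,
the products `ℓ_0^{e_0} ⋯ ℓ_{r-1}^{e_{r-1}}` (with `0 ≤ e_i < p`) form an `𝔽_q`-basis of
the space of polynomials of degree less than `p^r`. -/
theorem linearized_polynomial_basis_of_subspace_chain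
    (p : ℕ) [Fact p.Prime] (Fq : Type*) [Field Fq] [Fintype Fq] [CharP Fq p]
    [Algebra (ZMod p) Fq]
    (r : ℕ) (hr : 0 < r) (hpr : p ^ r ≤ Fintype.card Fq)
    (W : Fin (r + 1) → Submodule (ZMod p) Fq)
    (hmono : ∀ i : Fin r, W i.castSucc < W i.succ)
    (hdim : ∀ i : Fin (r + 1), Module.finrank (ZMod p) (W i) = (i : ℕ)) :
    LinearIndependent Fq (fun e : Fin r → Fin p =>
      ∏ i : Fin r,
        (∏ w ∈ (Set.toFinite ((W i.castSucc) : Set Fq)).toFinset, (X - C w)) ^ (e i : ℕ)) ∧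
    Submodule.span Fq (Set.range fun e : Fin r → Fin p =>
      ∏ i : Fin r,
        (∏ w ∈ (Set.toFinite ((W i.castSucc) : Set Fq)).toFinset, (X - C w)) ^ (e i : ℕ))
      = Polynomial.degreeLT Fq (p ^ r) := by
  refine linearIndependent_and_span_eq_degreeLT_of_degree_eq finFunctionFinEquiv _ fun e => ?_
  have hmonic (s : Finset Fq) : (∏ w ∈ s, (X - C w)).Monic :=
    monic_prod_of_monic _ _ fun w _ => monic_X_sub_C w
  have hdeg (i : Fin r) :
      (∏ w ∈ (Set.toFinite ((W i.castSucc) : Set Fq)).toFinset, (X - C w)).natDegree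
        = p ^ (i : ℕ) := by
    rw [natDegree_finsetProd_X_sub_C_eq_card, ← Set.ncard_eq_toFinset_card,
      ← Nat.card_coe_set_eq]
    change Nat.card (W i.castSucc) = _
    rw [Module.natCard_eq_pow_finrank (K := ZMod p), hdim, Nat.card_zmod, Fin.val_castSucc]
  rw [degree_eq_natDegree (monic_prod_of_monic _ _ fun i _ => (hmonic _).pow _).ne_zero,
    natDegree_prod_of_monic _ _ fun i _ => (hmonic _).pow _, finFunctionFinEquiv_apply]
  simp only [(hmonic _).natDegree_pow, hdeg]
end

section
/- Let G be a subgroup of ⟨σ⟩ of order n and set z = Σ_{τ∈G} τ(x) ∈ 𝔽_q(x). Then the fixed field 𝔽_q(x)^G = { u ∈ 𝔽_q(x) : τ(u) = u for all τ ∈ G } equals the subfield 𝔽_q(z) generated by z over 𝔽_q, and the field extension degree [𝔽_q(x) : 𝔽_q(z)] equals n. -/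
open Polynomial

namespace RatFunc

variable {K : Type*} [Field K]

theorem algEquiv_eq_one_of_apply_X {τ : RatFunc K ≃ₐ[K] RatFunc K}
    (h : τ (RatFunc.X : RatFunc K) = RatFunc.X) : τ = 1 := by
  have hp (p : K[X]) : τ (algebraMap K[X] (RatFunc K) p) = algebraMap K[X] (RatFunc K) p := by
    induction p using Polynomial.induction_on' with
    | add p q hp hq => simp only [map_add, hp, hq]
    | monomial n c =>
      have hc : τ (RatFunc.C c) = RatFunc.C c := τ.commutes c
      rw [← C_mul_X_pow_eq_monomial, map_mul, map_pow, RatFunc.algebraMap_X,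
        RatFunc.algebraMap_C, map_mul, map_pow, h, hc]
  ext f
  rw [← RatFunc.num_div_denom f, map_div₀, hp, hp, AlgEquiv.one_apply]

theorem max_natDegree_num_denom_le {f : RatFunc K} {p q : K[X]} {n : ℕ} (hq : q ≠ 0)
    (hf : f = algebraMap K[X] (RatFunc K) p / algebraMap K[X] (RatFunc K) q)
    (hpn : p.natDegree ≤ n) (hqn : q.natDegree ≤ n) :
    max f.num.natDegree f.denom.natDegree ≤ n := by
  subst hf
  refine max_le ?_ ((natDegree_le_of_dvd (RatFunc.denom_div_dvd p q) hq).trans hqn)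
  by_cases hp : p = 0
  · simp [hp]
  · exact (natDegree_le_of_dvd (RatFunc.num_div_dvd p hq) hp).trans hpn

theorem exists_sum_eq_div_of_natDegree_le_one {ι : Type*} (s : Finset ι) (f : ι → RatFunc K)
    (hf : ∀ i ∈ s, ∃ p q : K[X], q ≠ 0 ∧ p.natDegree ≤ 1 ∧ q.natDegree ≤ 1 ∧
      f i = algebraMap K[X] (RatFunc K) p / algebraMap K[X] (RatFunc K) q) :
    ∃ p q : K[X], q ≠ 0 ∧ p.natDegree ≤ s.card ∧ q.natDegree ≤ s.card ∧
      ∑ i ∈ s, f i = algebraMap K[X] (RatFunc K) p / algebraMap K[X] (RatFunc K) q := by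
  classical
  induction s using Finset.induction_on with
  | empty => exact ⟨0, 1, one_ne_zero, by simp⟩
  | insert i s hi ih =>
    obtain ⟨p, q, hq, hpn, hqn, h⟩ := ih fun j hj => hf j (Finset.mem_insert_of_mem hj)
    obtain ⟨r, t, ht, hrn, htn, h'⟩ := hf i (Finset.mem_insert_self i s)
    refine ⟨r * q + t * p, t * q, mul_ne_zero ht hq, ?_, ?_, ?_⟩
    · rw [Finset.card_insert_of_notMem hi]
      refine natDegree_add_le_of_degree_le ?_ ?_
      · exact natDegree_mul_le.trans (by omega)
      · exact natDegree_mul_le.trans (by omega)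
    · rw [Finset.card_insert_of_notMem hi]
      exact natDegree_mul_le.trans (by omega)
    · rw [Finset.sum_insert hi, h, h', div_add_div _ _ (RatFunc.algebraMap_ne_zero ht)
        (RatFunc.algebraMap_ne_zero hq)]
      simp only [map_add, map_mul]

theorem one_lt_inftyValuation_X_add_sum [DecidableEq (RatFunc K)] {ι : Type*} (s : Finset ι)
    (f : ι → RatFunc K) (hf : ∀ i ∈ s, RatFunc.inftyValuation K (f i) ≤ 1) :
    1 < RatFunc.inftyValuation K (RatFunc.X + ∑ i ∈ s, f i) := by
  have hX : 1 < RatFunc.inftyValuation K (RatFunc.X : RatFunc K) := by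
    rw [RatFunc.inftyValuation.X, ← WithZero.exp_zero, WithZero.exp_lt_exp]
    exact zero_lt_one
  rwa [Valuation.map_add_eq_of_lt_left _ ((Valuation.map_sum_le _ hf).trans_lt hX)]

theorem not_exists_eq_C_of_one_lt_inftyValuation [DecidableEq (RatFunc K)] {f : RatFunc K}
    (hf : 1 < RatFunc.inftyValuation K f) : ¬∃ c, f = RatFunc.C c := by
  rintro ⟨c, rfl⟩
  by_cases hc : c = 0
  · simp [hc] at hf
  · rw [RatFunc.inftyValuation.C K hc] at hf
    exact lt_irrefl _ hf

theorem inftyValuation_div_le_one [DecidableEq (RatFunc K)] {p q : K[X]} (hq : q ≠ 0)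
    (h : p.natDegree ≤ q.natDegree) :
    RatFunc.inftyValuation K
      (algebraMap K[X] (RatFunc K) p / algebraMap K[X] (RatFunc K) q) ≤ 1 := by
  by_cases hp : p = 0
  · simp [hp]
  · have hv {r : K[X]} (hr : r ≠ 0) : RatFunc.inftyValuation K (algebraMap K[X] (RatFunc K) r) =
        WithZero.exp (r.natDegree : ℤ) := RatFunc.inftyValuation.polynomial K hr
    rw [map_div₀, hv hp, hv hq, ← WithZero.exp_sub, ← WithZero.exp_zero, WithZero.exp_le_exp]
    omega

theorem linear_ne_zero {b u v : K} (a : K) (hb : b ≠ 0) (huv : u ≠ 0 ∨ v ≠ 0) :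
    (Polynomial.C (-(b * v)) * Polynomial.X + Polynomial.C (u - a * v) : K[X]) ≠ 0 := by
  intro h
  have h1 := congrArg (fun p => p.coeff 1) h
  have h0 := congrArg (fun p => p.coeff 0) h
  simp [coeff_C, hb] at h0 h1
  simp [h1] at h0
  tauto

theorem exists_pow_apply_X_eq {a b : K} (hb : b ≠ 0) {σ : RatFunc K ≃ₐ[K] RatFunc K}
    (hσ : σ RatFunc.X = 1 / (-(RatFunc.C b) * RatFunc.X - RatFunc.C a)) (k : ℕ) :
    ∃ u v : K, (u ≠ 0 ∨ v ≠ 0) ∧ (σ ^ k) RatFunc.X =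
      algebraMap K[X] (RatFunc K) (Polynomial.C u * Polynomial.X + Polynomial.C v) /
      algebraMap K[X] (RatFunc K)
        (Polynomial.C (-(b * v)) * Polynomial.X + Polynomial.C (u - a * v)) := by
  induction k with
  | zero => exact ⟨1, 0, by simp, by simp⟩
  | succ k ih =>
    obtain ⟨u, v, huv, h⟩ := ih
    have huv' : -(b * v) ≠ 0 ∨ u - a * v ≠ 0 := by
      by_contra! hc
      obtain ⟨h1, h2⟩ := hc
      have hv : v = 0 := by simpa [hb] using h1
      simp [hv] at h2
      tauto
    refine ⟨-(b * v), u - a * v, huv', ?_⟩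
    have hE := RatFunc.algebraMap_ne_zero (linear_ne_zero a hb huv)
    have hE' := RatFunc.algebraMap_ne_zero (linear_ne_zero a hb huv')
    have hC (c : K) : (σ ^ k) (RatFunc.C c) = RatFunc.C c := (σ ^ k).commutes c
    rw [pow_succ, AlgEquiv.mul_apply, hσ]
    simp only [map_div₀, map_one, map_sub, map_mul, map_neg, hC]
    rw [h]
    simp only [map_add, map_mul, map_sub, map_neg, RatFunc.algebraMap_C, RatFunc.algebraMap_X]
      at hE hE' ⊢
    rw [eq_div_iff hE']
    set E := -(RatFunc.C b * RatFunc.C v) * RatFunc.X +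
      (RatFunc.C u - RatFunc.C a * RatFunc.C v) with hEdef
    have key : -(RatFunc.C b * (RatFunc.C u - RatFunc.C a * RatFunc.C v)) * RatFunc.X +
        (-(RatFunc.C b * RatFunc.C v) - RatFunc.C a * (RatFunc.C u - RatFunc.C a * RatFunc.C v)) =
        (-RatFunc.C b * ((RatFunc.C u * RatFunc.X + RatFunc.C v) / E) - RatFunc.C a) * E := by
      rw [sub_mul, mul_assoc, div_mul_cancel₀ _ hE, hEdef]
      ring
    rw [key] at hE' ⊢
    rw [one_div, inv_mul_cancel_left₀ (left_ne_zero_of_mul hE')]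

theorem inftyValuation_pow_apply_X_le_one [DecidableEq (RatFunc K)] {a b : K} (hb : b ≠ 0)
    {σ : RatFunc K ≃ₐ[K] RatFunc K}
    (hσ : σ RatFunc.X = 1 / (-(RatFunc.C b) * RatFunc.X - RatFunc.C a)) {k : ℕ}
    (hk : σ ^ k ≠ 1) : RatFunc.inftyValuation K ((σ ^ k) RatFunc.X) ≤ 1 := by
  obtain ⟨u, v, huv, h⟩ := exists_pow_apply_X_eq hb hσ k
  have hv : v ≠ 0 := by
    rintro rfl
    have hu : u ≠ 0 := by tauto
    refine hk (algEquiv_eq_one_of_apply_X ?_)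
    have hCu : (RatFunc.C u : RatFunc K) ≠ 0 := by simpa using hu
    rw [h]
    simp [hCu]
  rw [h]
  refine inftyValuation_div_le_one (linear_ne_zero a hb huv) ?_
  rw [natDegree_linear (neg_ne_zero.mpr (mul_ne_zero hb hv))]
  exact natDegree_linear_le

end RatFunc

/-- **Fixed field of a subgroup of the order-`(q+1)` cyclic automorphism group.**
Let `m(X) = X² + aX + b` be a primitive polynomial over `𝔽_q` and let `σ` be the
automorphism of `𝔽_q(x)` with `σ(x) = 1/(-bx - a)`, of order `q+1`.  If `G ≤ ⟨σ⟩` has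
order `n` and `z = Σ_{τ∈G} τ(x)`, then the fixed field of `G` equals `𝔽_q(z)` and
`[𝔽_q(x) : 𝔽_q(z)] = n`. -/
theorem fixedField_of_cyclic_subgroup_eq_adjoin_sum
    (Fq : Type*) [Field Fq] [Fintype Fq] (a b : Fq)
    (m : Polynomial Fq) (hm : m = X ^ 2 + C a * X + C b)
    (hirr : Irreducible m)
    (hprim : orderOf (AdjoinRoot.root m) = Fintype.card Fq ^ 2 - 1)
    (σ : RatFunc Fq ≃ₐ[Fq] RatFunc Fq)
    (hσ : σ RatFunc.X = 1 / (-(RatFunc.C b) * RatFunc.X - RatFunc.C a))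
    (horder : orderOf σ = Fintype.card Fq + 1)
    (n : ℕ) (G : Subgroup (RatFunc Fq ≃ₐ[Fq] RatFunc Fq)) [Fintype G]
    (hG : G ≤ Subgroup.zpowers σ) (hn : Fintype.card G = n) :
    IntermediateField.fixedField G =
      IntermediateField.adjoin Fq
        {∑ τ : G, (τ : RatFunc Fq ≃ₐ[Fq] RatFunc Fq) RatFunc.X} ∧
    Module.finrank
      (IntermediateField.adjoin Fq
        {∑ τ : G, (τ : RatFunc Fq ≃ₐ[Fq] RatFunc Fq) RatFunc.X})
      (RatFunc Fq) = n := by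
  classical
  have hb : b ≠ 0 := by
    rintro rfl
    have hC : σ (RatFunc.C (1 / -a)) = RatFunc.C (1 / -a) := σ.commutes _
    have hX : (RatFunc.X : RatFunc Fq) = RatFunc.C (1 / -a) :=
      σ.injective (by rw [hC, hσ]; simp)
    refine RatFunc.not_exists_eq_C_of_one_lt_inftyValuation ?_ ⟨_, hX⟩
    simpa using RatFunc.one_lt_inftyValuation_X_add_sum (K := Fq) (∅ : Finset ℕ) 0 (by simp)
  have hfin : IsOfFinOrder σ := orderOf_pos_iff.mp (by omega)
  have hpow (τ : G) : ∃ k : ℕ, σ ^ k = τ := hfin.mem_powers_iff_mem_zpowers.mpr (hG τ.2)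
  set z : RatFunc Fq := ∑ τ : G, (τ : RatFunc Fq ≃ₐ[Fq] RatFunc Fq) RatFunc.X with hz
  have hzC : ¬∃ c, z = RatFunc.C c := by
    apply RatFunc.not_exists_eq_C_of_one_lt_inftyValuation
    rw [hz, ← Finset.add_sum_erase _ _ (Finset.mem_univ (1 : G))]
    refine RatFunc.one_lt_inftyValuation_X_add_sum _ _ fun τ hτ => ?_
    obtain ⟨k, hk⟩ := hpow τ
    rw [← hk]
    refine RatFunc.inftyValuation_pow_apply_X_le_one hb hσ fun h => Finset.ne_of_mem_erase hτ ?_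
    exact Subtype.ext (hk.symm.trans h)
  have hle : Module.finrank (IntermediateField.adjoin Fq {z}) (RatFunc Fq) ≤ n := by
    obtain ⟨p, q, hq, hpn, hqn, h⟩ := RatFunc.exists_sum_eq_div_of_natDegree_le_one
      (Finset.univ : Finset G) (fun τ => (τ : RatFunc Fq ≃ₐ[Fq] RatFunc Fq) RatFunc.X) <| by
        intro τ _
        obtain ⟨k, hk⟩ := hpow τ
        obtain ⟨u, v, huv, h⟩ := RatFunc.exists_pow_apply_X_eq hb hσ k
        exact ⟨_, _, RatFunc.linear_ne_zero a hb huv, natDegree_linear_le, natDegree_linear_le,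
          by rw [← hk, h]⟩
    rw [Finset.card_univ, hn] at hpn hqn
    rw [RatFunc.finrank_eq_max_natDegree]
    exact RatFunc.max_natDegree_num_denom_le hq h hpn hqn
  have hpos : 0 < Module.finrank (IntermediateField.adjoin Fq {z}) (RatFunc Fq) := by
    rw [RatFunc.finrank_eq_max_natDegree, Nat.pos_iff_ne_zero]
    intro h
    rw [Nat.max_eq_zero_iff, ← RatFunc.eq_C_iff] at h
    exact hzC h
  have : FiniteDimensional (IntermediateField.adjoin Fq {z}) (RatFunc Fq) :=
    Module.finite_of_finrank_pos hpos
  have hfix : Module.finrank (IntermediateField.fixedField G) (RatFunc Fq) = n :=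
    (FixedPoints.finrank_eq_card G (RatFunc Fq)).trans hn
  have hsub : IntermediateField.adjoin Fq {z} ≤ IntermediateField.fixedField G := by
    rw [IntermediateField.adjoin_simple_le_iff, IntermediateField.mem_fixedField_iff]
    intro τ hτ
    rw [hz, map_sum]
    exact Fintype.sum_equiv (Equiv.mulLeft (⟨τ, hτ⟩ : G)) _ _ fun _ => rfl
  have heq := IntermediateField.eq_of_le_of_finrank_le' hsub (hle.trans hfix.ge)
  exact ⟨heq.symm, by rw [heq, hfix]⟩
end

section
/- Let G be a subgroup of ⟨σ⟩ of order n and set z = Σ_{τ∈G} τ(x) ∈ 𝔽_q(x). Then there exist a polynomial u ∈ 𝔽_q[X] of degree n and pairwise distinct elements α_1,…,α_{n−1} ∈ 𝔽_q such that z = u(x) / ∏_{j=1}^{n−1}(x − α_j) in 𝔽_q(x), where u(X) is coprime to ∏_{j=1}^{n−1}(X − α_j). (Equivalently, the pole place of z splits completely into n rational places of 𝔽_q(x), one of which is the pole of x.) -/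
open Polynomial

/-- An automorphism of `K(x)` is determined by the image of `x`. -/
theorem ratFunc_algEquiv_ext_X {K : Type*} [Field K] {σ τ : RatFunc K ≃ₐ[K] RatFunc K}
    (h : σ RatFunc.X = τ RatFunc.X) : σ = τ := by
  have hp : (σ : RatFunc K →ₐ[K] RatFunc K).comp (IsScalarTower.toAlgHom K K[X] (RatFunc K)) =
      (τ : RatFunc K →ₐ[K] RatFunc K).comp (IsScalarTower.toAlgHom K K[X] (RatFunc K)) := by
    apply Polynomial.algHom_ext
    simpa [RatFunc.algebraMap_X] using h
  have hp' (p : K[X]) : σ (algebraMap K[X] (RatFunc K) p) = τ (algebraMap K[X] (RatFunc K) p) :=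
    DFunLike.congr_fun hp p
  ext f
  rw [← RatFunc.num_div_denom f, map_div₀, map_div₀, hp', hp']

theorem ratFunc_X_sub_C_ne_zero {K : Type*} [Field K] (α : K) :
    (RatFunc.X - RatFunc.C α : RatFunc K) ≠ 0 := by
  have h : (algebraMap K[X] (RatFunc K)) (X - C α) ≠ 0 :=
    RatFunc.algebraMap_ne_zero (Polynomial.X_sub_C_ne_zero α)
  simpa using h

/-- A sum of `x` and constants and simple poles at distinct points is a reduced fraction. -/
theorem ratFunc_X_add_sum_simple_poles {K : Type*} [Field K] {N : ℕ} (α c d : Fin N → K)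
    (hα : Function.Injective α) (hd : ∀ i, d i ≠ 0) :
    ∃ u : K[X], u.natDegree = N + 1 ∧ IsCoprime u (∏ j, (X - C (α j))) ∧
      (RatFunc.X + ∑ i, (RatFunc.C (c i) + RatFunc.C (d i) / (RatFunc.X - RatFunc.C (α i)))) =
        algebraMap K[X] (RatFunc K) u / algebraMap K[X] (RatFunc K) (∏ j, (X - C (α j))) := by
  set D : K[X] := ∏ j, (X - C (α j)) with hD
  set R : K[X] := ∑ i, C (d i) * ∏ j ∈ Finset.univ.erase i, (X - C (α j)) with hR
  have hDm : D.Monic := monic_prod_of_monic _ _ fun j _ => monic_X_sub_C _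
  have hDdeg : D.natDegree = N := by simp [hD]
  have hRdeg : R.natDegree ≤ N := by
    refine natDegree_sum_le_of_forall_le _ _ fun i _ => ?_
    refine (natDegree_C_mul_le _ _).trans ?_
    rw [natDegree_finsetProd_X_sub_C_eq_card]
    simp
  have hXD : ((X + C (∑ i, c i)) * D).natDegree = N + 1 := by
    rw [(monic_X_add_C _).natDegree_mul hDm, hDdeg, natDegree_X_add_C, add_comm]
  refine ⟨(X + C (∑ i, c i)) * D + R, ?_, ?_, ?_⟩
  · rw [natDegree_add_eq_left_of_natDegree_lt (by omega), hXD]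
  · refine IsCoprime.prod_right fun j _ => ?_
    refine ((irreducible_X_sub_C (α j)).coprime_iff_not_dvd.2 ?_).symm
    have hDj : D.eval (α j) = 0 := by
      rw [hD, eval_prod]
      exact Finset.prod_eq_zero (Finset.mem_univ j) (by simp)
    have hRj : R.eval (α j) = d j * ∏ k ∈ Finset.univ.erase j, (α j - α k) := by
      rw [hR, eval_finsetSum, Finset.sum_eq_single j]
      · simp [eval_prod]
      · intro i _ hij
        rw [eval_mul, eval_prod, Finset.prod_eq_zero (i := j), mul_zero]
        · simpa using hij.symm
        · simp
      · simp
    rw [dvd_iff_isRoot, IsRoot.def, eval_add, eval_mul, hDj, mul_zero, zero_add, hRj]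
    refine mul_ne_zero (hd j) (Finset.prod_ne_zero_iff.2 fun k hk => ?_)
    rw [sub_ne_zero]
    exact fun h => (Finset.ne_of_mem_erase hk) (hα h).symm
  · have hD0 : algebraMap K[X] (RatFunc K) D ≠ 0 := RatFunc.algebraMap_ne_zero hDm.ne_zero
    rw [eq_div_iff hD0, map_add, map_mul, hR, Finset.sum_add_distrib, ← add_assoc,
      add_mul, Finset.sum_mul, map_sum (algebraMap K[X] (RatFunc K)) _ Finset.univ]
    refine congrArg₂ (· + ·) ?_ (Finset.sum_congr rfl fun i _ => ?_)
    · simp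
    · rw [hD, ← Finset.mul_prod_erase _ _ (Finset.mem_univ i)]
      have := ratFunc_X_sub_C_ne_zero (α i)
      simp only [map_mul, map_sub, RatFunc.algebraMap_X, RatFunc.algebraMap_C]
      field_simp

/-- The elements of `⟨σ⟩` act on `x` through the matrices commuting with that of `σ`. -/
theorem pow_apply_X_mul {K : Type*} [Field K] {a b : K} (hb : b ≠ 0)
    {σ : RatFunc K ≃ₐ[K] RatFunc K}
    (hσ : σ RatFunc.X = 1 / (-(RatFunc.C b) * RatFunc.X - RatFunc.C a)) (k : ℕ) :
    ∃ s t : K, (s ≠ 0 ∨ t ≠ 0) ∧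
      (σ ^ k) RatFunc.X * (RatFunc.C (-b * s) * RatFunc.X + RatFunc.C (t - a * s)) =
        RatFunc.C t * RatFunc.X + RatFunc.C s := by
  have hC (y : K) : σ (RatFunc.C y) = RatFunc.C y := by
    rw [← RatFunc.algebraMap_eq_C]; exact σ.commutes y
  induction k with
  | zero => exact ⟨0, 1, by simp⟩
  | succ k ih =>
    obtain ⟨s, t, hst, h⟩ := ih
    refine ⟨t - a * s, -b * s, ?_, ?_⟩
    · by_contra! hh
      have hs : s = 0 := by simpa [hb] using hh.2
      have ht : t = 0 := by simpa [hs] using hh.1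
      simp [hs, ht] at hst
    · have hne : (-(RatFunc.C b) * RatFunc.X - RatFunc.C a : RatFunc K) ≠ 0 := by
        have hb' : (RatFunc.C b : RatFunc K) ≠ 0 := by simpa using hb
        have h1 := mul_ne_zero (neg_ne_zero.2 hb') (ratFunc_X_sub_C_ne_zero (-(a / b)))
        convert h1 using 1
        rw [map_neg, map_div₀]
        field_simp
        ring
      have h2 := congrArg σ h
      simp only [map_mul, map_add, hC, hσ] at h2
      rw [pow_succ', AlgEquiv.mul_apply]
      generalize σ ((σ ^ k) RatFunc.X) = y at h2 ⊢
      simp only [map_mul, map_sub, map_neg] at h2 ⊢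
      rw [neg_mul] at hne
      field_simp at h2
      linear_combination h2

/-- A nontrivial element of `⟨σ⟩` sends `x` to a fractional linear expression with a pole at some
`α ∈ K`, and is determined by `α`. -/
theorem exists_apply_X_eq_of_mem_zpowers {K : Type*} [Field K] {a b : K} (hb : b ≠ 0)
    {σ : RatFunc K ≃ₐ[K] RatFunc K}
    (hσ : σ RatFunc.X = 1 / (-(RatFunc.C b) * RatFunc.X - RatFunc.C a)) (hfin : IsOfFinOrder σ)
    {τ : RatFunc K ≃ₐ[K] RatFunc K} (hτ : τ ∈ Subgroup.zpowers σ) (hτ1 : τ ≠ 1) :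
    ∃ α : K, τ RatFunc.X = RatFunc.C (-(b * α + a) / b) +
      RatFunc.C (-(b * α ^ 2 + a * α + 1) / b) / (RatFunc.X - RatFunc.C α) := by
  obtain ⟨k, rfl⟩ := hfin.mem_powers_iff_mem_zpowers.2 hτ
  obtain ⟨s, t, hst, h⟩ := pow_apply_X_mul hb hσ k
  have hs : s ≠ 0 := by
    rintro rfl
    have ht : (RatFunc.C t : RatFunc K) ≠ 0 := by simpa using hst
    refine hτ1 (ratFunc_algEquiv_ext_X ?_)
    simp only [mul_zero, map_zero, zero_mul, zero_add, sub_zero, add_zero] at h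
    rw [mul_comm] at h
    exact mul_left_cancel₀ ht h
  refine ⟨(t - a * s) / (b * s), ?_⟩
  have hX := ratFunc_X_sub_C_ne_zero ((t - a * s) / (b * s))
  obtain ⟨α, hα⟩ : ∃ α, α = (t - a * s) / (b * s) := ⟨_, rfl⟩
  have ht : t = b * α * s + a * s := by rw [hα]; field_simp; ring
  rw [← hα] at hX ⊢
  have hb' : (RatFunc.C b : RatFunc K) ≠ 0 := by simpa using hb
  have hs' : (RatFunc.C s : RatFunc K) ≠ 0 := by simpa using hs
  simp only [ht, map_div₀, map_mul, map_add, map_neg, map_pow, map_sub, map_one] at h ⊢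
  generalize (σ ^ k) RatFunc.X = y at h ⊢
  field_simp
  apply mul_left_cancel₀ hs'
  linear_combination -h

/-- **Pole structure of the trace generator `z = Σ_{τ∈G} τ(x)`.**
With `σ` of order `q+1` coming from a primitive quadratic `m(X) = X² + aX + b`, and
`G ≤ ⟨σ⟩` of order `n`, there exist a polynomial `u` of degree `n` and pairwise distinct
`α_1, …, α_{n-1} ∈ 𝔽_q` with `z = u(x)/∏_j (x - α_j)`, where `u` is coprime to the
denominator. -/
theorem sum_over_cyclic_subgroup_eq_ratio
    (Fq : Type*) [Field Fq] [Fintype Fq] (a b : Fq)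
    (m : Polynomial Fq) (hm : m = X ^ 2 + C a * X + C b)
    (hirr : Irreducible m)
    (hprim : orderOf (AdjoinRoot.root m) = Fintype.card Fq ^ 2 - 1)
    (σ : RatFunc Fq ≃ₐ[Fq] RatFunc Fq)
    (hσ : σ RatFunc.X = 1 / (-(RatFunc.C b) * RatFunc.X - RatFunc.C a))
    (horder : orderOf σ = Fintype.card Fq + 1)
    (n : ℕ) (G : Subgroup (RatFunc Fq ≃ₐ[Fq] RatFunc Fq)) [Fintype G]
    (hG : G ≤ Subgroup.zpowers σ) (hn : Fintype.card G = n) :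
    ∃ (u : Polynomial Fq) (α : Fin (n - 1) → Fq),
      u.natDegree = n ∧ Function.Injective α ∧
      IsCoprime u (∏ j, (X - C (α j))) ∧
      (∑ τ : G, (τ : RatFunc Fq ≃ₐ[Fq] RatFunc Fq) RatFunc.X) =
        algebraMap (Polynomial Fq) (RatFunc Fq) u /
          algebraMap (Polynomial Fq) (RatFunc Fq) (∏ j, (X - C (α j))) := by
  classical
  have hroot (y : Fq) : y ^ 2 + a * y + b ≠ 0 := by
    intro hy
    have hdeg : m.natDegree = 2 := by rw [hm]; compute_degree!
    refine hirr.not_isRoot_of_natDegree_ne_one (x := y) (by omega) ?_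
    simpa [hm, IsRoot.def] using hy
  have hb : b ≠ 0 := by simpa using hroot 0
  have hd (y : Fq) : -(b * y ^ 2 + a * y + 1) / b ≠ 0 := by
    refine div_ne_zero (neg_ne_zero.2 fun hy => ?_) hb
    have hy0 : y ≠ 0 := by rintro rfl; simp at hy
    apply hroot y⁻¹
    field_simp
    linear_combination hy
  have hfin : IsOfFinOrder σ := orderOf_pos_iff.1 (by omega)
  have hpos : 0 < n := hn ▸ Fintype.card_pos
  have hcard : Fintype.card {τ : G // τ ≠ 1} = n - 1 := by
    rw [← hn]; simp [Fintype.card_subtype_compl]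
  let e : Fin (n - 1) ≃ {τ : G // τ ≠ 1} := (Fintype.equivFinOfCardEq hcard).symm
  have hpole (i : Fin (n - 1)) := exists_apply_X_eq_of_mem_zpowers hb hσ hfin (hG (e i).1.2)
    (fun h => (e i).2 (Subtype.ext h))
  choose α hα using hpole
  have hinj : Function.Injective α := fun i j hij =>
    e.injective (Subtype.ext (Subtype.ext (ratFunc_algEquiv_ext_X (by rw [hα, hα, hij]))))
  obtain ⟨u, hu, hcop, hsum⟩ := ratFunc_X_add_sum_simple_poles α _ _ hinj (fun i => hd (α i))
  refine ⟨u, α, by omega, hinj, hcop, ?_⟩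
  rw [← hsum, Fintype.sum_eq_add_sum_subtype_ne _ (1 : G), ← e.sum_comp]
  congr 1
  exact Finset.sum_congr rfl fun i _ => hα i
end

section
/- Let G be a subgroup of ⟨σ⟩ of order n and set y = ∏_{τ∈G} τ(1/Q(x)) ∈ 𝔽_q(x). Then there exist c ∈ 𝔽_q^× and pairwise distinct elements α_1,…,α_{n−1} ∈ 𝔽_q such that y = c · ∏_{j=1}^{n−1}(x − α_j)^2 / Q(x)^n in 𝔽_q(x); moreover the α_1,…,α_{n−1} can be taken to be the same elements for which Σ_{τ∈G} τ(x) = u(x)/∏_{j=1}^{n−1}(x − α_j) with u ∈ 𝔽_q[X] of degree n. -/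
open Polynomial

namespace RatFunc

variable {F : Type*} [Field F]

lemma X_sub_C_ne_zero (α : F) : (X : RatFunc F) - C α ≠ 0 := by
  rw [← algebraMap_X, ← algebraMap_C, ← map_sub]
  exact algebraMap_ne_zero (Polynomial.X_sub_C_ne_zero α)

lemma algEquiv_C (τ : RatFunc F ≃ₐ[F] RatFunc F) (r : F) : τ (C r) = C r := by
  rw [← algebraMap_eq_C]
  exact τ.commutes r

lemma algEquiv_ext {τ τ' : RatFunc F ≃ₐ[F] RatFunc F} (h : τ X = τ' X) : τ = τ' := by
  have hp (ρ : RatFunc F ≃ₐ[F] RatFunc F) (p : F[X]) :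
      ρ (algebraMap F[X] (RatFunc F) p) = aeval (ρ X) p := by
    rw [← aeval_X_left_eq_algebraMap]
    exact (aeval_algHom_apply (ρ : RatFunc F →ₐ[F] RatFunc F) X p).symm
  ext f
  rw [← num_div_denom f, map_div₀, map_div₀, hp, hp, hp, hp, h]

/-- A nontrivial power of the automorphism `x ↦ 1 / (-b x - a)` is a linear fractional
transformation determined by its pole `α`. -/
lemma eq_one_or_exists_pole_of_mem_zpowers {a b : F} (hb : b ≠ 0)
    {σ : RatFunc F ≃ₐ[F] RatFunc F} (hσ : σ X = 1 / (-(C b) * X - C a)) (hfin : IsOfFinOrder σ)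
    {τ : RatFunc F ≃ₐ[F] RatFunc F} (hτ : τ ∈ Subgroup.zpowers σ) :
    τ = 1 ∨ ∃ α : F, τ X = (C (b * α + a) * X + 1) / (-(C b) * (X - C α)) := by
  have hB : C b ≠ 0 := (_root_.map_ne_zero C).2 hb
  rw [← hfin.mem_powers_iff_mem_zpowers] at hτ
  obtain ⟨k, rfl⟩ := hτ
  induction k with
  | zero => exact Or.inl (pow_zero σ)
  | succ k ih =>
    simp only at ih ⊢
    rw [pow_succ]
    rcases ih with h | ⟨α, h⟩
    · right
      refine ⟨-a / b, ?_⟩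
      rw [h, one_mul, hσ]
      simp only [map_add, map_mul, map_div₀, map_neg]
      congr 1
      · field_simp; ring
      · field_simp; ring
    · have hmul : (σ ^ k * σ) X = 1 / (-(C b) * (σ ^ k) X - C a) := by
        rw [AlgEquiv.mul_apply, hσ]
        simp only [map_div₀, map_one, map_sub, map_mul, map_neg, algEquiv_C]
      by_cases hα : α = 0
      · left
        apply algEquiv_ext
        rw [hmul, h, hα]
        have hX : (X : RatFunc F) ≠ 0 := X_ne_zero
        have key : -(C b) * ((C (b * 0 + a) * X + 1) / (-(C b) * (X - C 0))) - C a = 1 / X := by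
          simp only [mul_zero, zero_add, map_zero, sub_zero]
          field_simp; ring
        rw [key, one_div_one_div, AlgEquiv.one_apply]
      · right
        refine ⟨-1 / (b * α) - a / b, ?_⟩
        have hA : C α ≠ 0 := (_root_.map_ne_zero C).2 hα
        have h1 := X_sub_C_ne_zero α
        have h2 := X_sub_C_ne_zero (-1 / (b * α) - a / b)
        rw [hmul, h]
        have key : -(C b) * ((C (b * α + a) * X + 1) / (-(C b) * (X - C α))) - C a
            = C b * C α * (X - C (-1 / (b * α) - a / b)) / (X - C α) := by
          simp only [map_add, map_mul, map_div₀, map_neg, map_sub, map_one]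
          field_simp; ring
        have key2 : C (b * (-1 / (b * α) - a / b) + a) = - 1 / C α := by
          rw [← map_one C, ← map_neg, ← map_div₀]
          congr 1
          field_simp; ring
        rw [key, key2]
        generalize X - C (-1 / (b * α) - a / b) = d at h2
        field_simp; ring

lemma algEquiv_one_div_quadratic {a b α : F} (hb : b ≠ 0)
    {τ : RatFunc F ≃ₐ[F] RatFunc F}
    (hτ : τ X = (C (b * α + a) * X + 1) / (-(C b) * (X - C α))) {Q : F[X]}
    (hQ : Q = Polynomial.X ^ 2 + Polynomial.C (a / b) * Polynomial.X + Polynomial.C (1 / b))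
    (hα : Q.eval α ≠ 0) :
    τ (1 / algebraMap F[X] (RatFunc F) Q) =
      C (Q.eval α)⁻¹ * (X - C α) ^ 2 / algebraMap F[X] (RatFunc F) Q := by
  have hB : C b ≠ 0 := (_root_.map_ne_zero C).2 hb
  have h1 := X_sub_C_ne_zero α
  have hE : C (Q.eval α) ≠ 0 := (_root_.map_ne_zero C).2 hα
  have hQm : algebraMap F[X] (RatFunc F) Q = X ^ 2 + C (a / b) * X + C (1 / b) := by
    simp [hQ, algebraMap_X, algebraMap_C]
  have hQ0 : algebraMap F[X] (RatFunc F) Q ≠ 0 :=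
    algebraMap_ne_zero fun h => hα (by simp [h])
  have key : τ (algebraMap F[X] (RatFunc F) Q) =
      C (Q.eval α) * algebraMap F[X] (RatFunc F) Q / (X - C α) ^ 2 := by
    have hev : Q.eval α = α ^ 2 + a / b * α + 1 / b := by simp [hQ]
    rw [hev, hQm]
    simp only [map_add, map_mul, map_pow, algEquiv_C, hτ]
    simp only [map_div₀, map_one]
    field_simp; ring
  rw [map_div₀, map_one, key, map_inv₀]
  field_simp

lemma sum_pole_expansion {ι : Type*} [Fintype ι] [DecidableEq ι] {a b : F} (hb : b ≠ 0)
    (α : ι → F) :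
    ∃ u : F[X], u.natDegree = Fintype.card ι + 1 ∧
      X + ∑ j, (C (b * α j + a) * X + 1) / (-(C b) * (X - C (α j))) =
        algebraMap F[X] (RatFunc F) u /
          algebraMap F[X] (RatFunc F) (∏ j, (Polynomial.X - Polynomial.C (α j))) := by
  have hB : C b ≠ 0 := (_root_.map_ne_zero C).2 hb
  let l (j : ι) : F[X] := Polynomial.X - Polynomial.C (α j)
  let t (j : ι) : F[X] := Polynomial.C (-1 / b) *
    (Polynomial.C (b * α j + a) * Polynomial.X + 1) * ∏ i ∈ Finset.univ.erase j, l i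
  have hl (j : ι) : algebraMap F[X] (RatFunc F) (l j) = X - C (α j) := by
    simp [l, algebraMap_X, algebraMap_C]
  have hmonic (s : Finset ι) : (∏ i ∈ s, l i).Monic :=
    monic_prod_of_monic _ _ fun i _ => monic_X_sub_C _
  have hdeg (s : Finset ι) : (∏ i ∈ s, l i).natDegree = s.card := by
    rw [natDegree_prod_of_monic _ _ fun i _ => monic_X_sub_C _]
    simp [l]
  have hmain : (Polynomial.X * ∏ i, l i).natDegree = Fintype.card ι + 1 := by
    rw [natDegree_X_mul (hmonic _).ne_zero, hdeg, Finset.card_univ]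
  refine ⟨Polynomial.X * ∏ i, l i + ∑ j, t j, ?_, ?_⟩
  · rw [natDegree_add_eq_left_of_natDegree_lt, hmain]
    rw [hmain, Nat.lt_succ_iff]
    refine natDegree_sum_le_of_forall_le _ _ fun j _ => ?_
    refine natDegree_mul_le.trans ?_
    rw [hdeg, Finset.card_erase_of_mem (Finset.mem_univ j), Finset.card_univ]
    have h1 : (Polynomial.C (-1 / b) *
        (Polynomial.C (b * α j + a) * Polynomial.X + 1)).natDegree ≤ 1 := by
      compute_degree
    have : 0 < Fintype.card ι := Fintype.card_pos_iff.2 ⟨j⟩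
    omega
  · have hP : algebraMap F[X] (RatFunc F) (∏ i, l i) ≠ 0 := algebraMap_ne_zero (hmonic _).ne_zero
    change _ = _ / algebraMap F[X] (RatFunc F) (∏ i, l i)
    rw [map_add, map_mul, add_div, mul_div_cancel_right₀ _ hP, algebraMap_X, map_sum,
      Finset.sum_div]
    congr 1
    refine Finset.sum_congr rfl fun j _ => ?_
    have hj := X_sub_C_ne_zero (α j)
    have hP' : algebraMap F[X] (RatFunc F) (∏ i ∈ Finset.univ.erase j, l i) ≠ 0 :=
      algebraMap_ne_zero (hmonic _).ne_zero
    rw [← Finset.mul_prod_erase _ _ (Finset.mem_univ j)]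
    simp only [t, map_mul, hl, map_add, map_one, algebraMap_C, algebraMap_X, map_div₀, map_neg]
    field_simp

end RatFunc

open Polynomial

/-- **Divisor structure of `y = ∏_{τ∈G} τ(1/Q(x))`.**
With `σ` of order `q+1` coming from a primitive quadratic `m(X) = X² + aX + b`,
`Q(X) = X² + (a/b)X + 1/b`, and `G ≤ ⟨σ⟩` of order `n`, there exist `c ∈ 𝔽_q^×` and
pairwise distinct `α_1, …, α_{n-1} ∈ 𝔽_q` with
`y = c·∏_j (x - α_j)² / Q(x)^n`; moreover the `α_j` can be taken to be the same elements
appearing in the expression `Σ_{τ∈G} τ(x) = u(x)/∏_j (x - α_j)` with `deg u = n`. -/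
theorem prod_over_cyclic_subgroup_eq_ratio
    (Fq : Type*) [Field Fq] [Fintype Fq] (a b : Fq)
    (m : Polynomial Fq) (hm : m = X ^ 2 + C a * X + C b)
    (hirr : Irreducible m)
    (hprim : orderOf (AdjoinRoot.root m) = Fintype.card Fq ^ 2 - 1)
    (σ : RatFunc Fq ≃ₐ[Fq] RatFunc Fq)
    (hσ : σ RatFunc.X = 1 / (-(RatFunc.C b) * RatFunc.X - RatFunc.C a))
    (horder : orderOf σ = Fintype.card Fq + 1)
    (Qp : Polynomial Fq) (hQ : Qp = X ^ 2 + C (a / b) * X + C (1 / b))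
    (n : ℕ) (G : Subgroup (RatFunc Fq ≃ₐ[Fq] RatFunc Fq)) [Fintype G]
    (hG : G ≤ Subgroup.zpowers σ) (hn : Fintype.card G = n) :
    ∃ (c : Fq) (α : Fin (n - 1) → Fq) (u : Polynomial Fq),
      c ≠ 0 ∧ Function.Injective α ∧ u.natDegree = n ∧
      (∑ τ : G, (τ : RatFunc Fq ≃ₐ[Fq] RatFunc Fq) RatFunc.X) =
        algebraMap (Polynomial Fq) (RatFunc Fq) u /
          algebraMap (Polynomial Fq) (RatFunc Fq) (∏ j, (X - C (α j))) ∧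
      (∏ τ : G, (τ : RatFunc Fq ≃ₐ[Fq] RatFunc Fq)
          (1 / algebraMap (Polynomial Fq) (RatFunc Fq) Qp)) =
        RatFunc.C c *
          algebraMap (Polynomial Fq) (RatFunc Fq) ((∏ j, (X - C (α j))) ^ 2) /
          algebraMap (Polynomial Fq) (RatFunc Fq) (Qp ^ n) := by
  classical
  have hb_root (r : Fq) : r ^ 2 + a * r + b ≠ 0 := by
    have hdeg : m.natDegree ≠ 1 := by
      have : m.natDegree = 2 := by rw [hm]; compute_degree!
      omega
    have := hirr.not_isRoot_of_natDegree_ne_one hdeg (x := r)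
    simpa [hm, IsRoot] using this
  have hb : b ≠ 0 := by simpa using hb_root 0
  have hQev (r : Fq) : Qp.eval r ≠ 0 := by
    intro h
    apply hb_root (-(b * r + a))
    have h' : r ^ 2 + a / b * r + 1 / b = 0 := by simpa [hQ] using h
    field_simp at h'
    linear_combination b * h'
  have hfin : IsOfFinOrder σ := orderOf_pos_iff.1 (by omega)
  have hpole (τ : {τ : G // τ ≠ 1}) : ∃ α : Fq, (τ : G).1 RatFunc.X =
      (RatFunc.C (b * α + a) * RatFunc.X + 1) / (-(RatFunc.C b) * (RatFunc.X - RatFunc.C α)) :=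
    (RatFunc.eq_one_or_exists_pole_of_mem_zpowers hb hσ hfin (hG τ.1.2)).resolve_left
      fun h => τ.2 (Subtype.ext h)
  choose β hβ using hpole
  have hβinj : Function.Injective β := fun τ τ' h =>
    Subtype.ext (Subtype.ext (RatFunc.algEquiv_ext (by rw [hβ, hβ, h])))
  have hcard : Fintype.card {τ : G // τ ≠ 1} = n - 1 := by
    rw [Fintype.card_subtype_compl, Fintype.card_subtype_eq, hn]
  have hn0 : 0 < n := hn ▸ Fintype.card_pos
  let e : Fin (n - 1) ≃ {τ : G // τ ≠ 1} := (Fintype.equivFinOfCardEq hcard).symm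
  obtain ⟨u, hu, hsum⟩ := RatFunc.sum_pole_expansion (a := a) hb (β ∘ e)
  refine ⟨∏ j, (Qp.eval (β (e j)))⁻¹, β ∘ e, u,
    Finset.prod_ne_zero_iff.2 fun j _ => inv_ne_zero (hQev _), hβinj.comp e.injective, ?_, ?_, ?_⟩
  · rw [hu, Fintype.card_fin]
    omega
  · rw [← hsum, Fintype.sum_eq_add_sum_subtype_ne _ (1 : G), ← e.sum_comp]
    simp only [hβ, OneMemClass.coe_one, AlgEquiv.one_apply, Function.comp_apply]
  · rw [Fintype.prod_eq_mul_prod_subtype_ne _ (1 : G), ← e.prod_comp]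
    simp only [fun τ => RatFunc.algEquiv_one_div_quadratic hb (hβ τ) hQ (hQev _),
      OneMemClass.coe_one, AlgEquiv.one_apply, Function.comp_apply]
    rw [Finset.prod_div_distrib, Finset.prod_mul_distrib, Finset.prod_const, Finset.card_univ,
      Fintype.card_fin, Finset.prod_pow, map_prod, map_pow, map_pow, map_prod,
      div_mul_div_comm, one_mul, ← pow_succ', Nat.sub_add_cancel hn0]
    simp only [map_sub, RatFunc.algebraMap_X, RatFunc.algebraMap_C]
end

section
/- Let n = p_1 p_2 ⋯ p_r be a divisor of q+1 and let {1} = G_0 < G_1 < ⋯ < G_r = G be an ascending chain of subgroups of ⟨σ⟩ with |G_i| = p_1⋯p_i. For 0 ≤ i ≤ r set x_i = Σ_{τ∈G_i} τ(x) (so x_0 = x), and set y_r = ∏_{τ∈G_r} τ(1/Q(x)). Suppose that for each 1 ≤ i ≤ r there are pairwise distinct elements λ_{i,1},…,λ_{i,p_i−1} ∈ 𝔽_q and a polynomial u_i ∈ 𝔽_q[T] of degree p_i with x_i = u_i(x_{i−1}) / ∏_{k=1}^{p_i−1}(x_{i−1} − λ_{i,k}) in 𝔽_q(x), and that there are pairwise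 distinct elements α_1,…,α_{n−1} ∈ 𝔽_q and a polynomial u_{r,0} ∈ 𝔽_q[X] of degree n with x_r = u_{r,0}(x)/∏_{j=1}^{n−1}(x − α_j). For 0 ≤ i ≤ r−1 define z_i^{(0)} = 1 and z_i^{(e)} = 1/∏_{k=1}^{e}(x_i − λ_{i+1,k}) for 1 ≤ e ≤ p_{i+1}−1. Then the set B̃ = { z_0^{(e_0)} z_1^{(e_1)} ⋯ z_{r−1}^{(e_{r−1})} · x_r · y_r : 0 ≤ e_i ≤ p_{i+1}−1 for 0 ≤ i ≤ r−1 } is an 𝔽_q-basis of the 𝔽_q-subspace { u_{r,0}(x) · g(x) / Q(x)^n : g ∈ 𝔽_q[X], deg g < n } of 𝔽_q(x); equivalently, { (Q(x)^n/u_{r,0}(x)) · w : w ∈ B̃ } is an 𝔽_q-basis of the space 𝔽_q[x]_{<n} of polynomials of degree less than n. -/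
open Polynomial

section PolynomialChain

variable {F : Type*} [Field F]

theorem degree_C_mul_le_degree (c : F) (P : F[X]) : (C c * P).degree ≤ P.degree := by
  rw [← smul_eq_C_mul]
  exact degree_smul_le c P

theorem natDegree_sub_C_mul {N P : F[X]} (h : P.degree < N.degree) (c : F) :
    (N - C c * P).natDegree = N.natDegree := by
  exact natDegree_eq_of_degree_eq <|
    degree_sub_eq_left_of_degree_lt ((degree_C_mul_le_degree c P).trans_lt h)

theorem sub_C_mul_ne_zero {N P : F[X]} (h : P.degree < N.degree) (c : F) :
    N - C c * P ≠ 0 := by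
  intro h0
  have := degree_sub_eq_left_of_degree_lt ((degree_C_mul_le_degree c P).trans_lt h)
  rw [h0, degree_zero] at this
  rw [← this] at h
  exact not_lt_bot h

theorem isCoprime_sub_C_mul {N P : F[X]} (h : IsCoprime N P) (c : F) :
    IsCoprime (N - C c * P) P := by
  rw [sub_eq_add_neg, ← neg_mul]
  exact h.add_mul_right_left _

theorem eq_zero_of_sum_mul_pow_mul_prod_eq_zero {N P : F[X]} (hcop : IsCoprime N P)
    (hdeg : P.degree < N.degree) (lam : ℕ → F) (q : ℕ) (a : Fin (q + 1) → F[X])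
    (ha : ∀ e, (a e).degree < N.degree)
    (hsum : ∑ e, a e * (P ^ (e : ℕ) * ∏ k ∈ Finset.Ico (e : ℕ) q, (N - C (lam k) * P)) = 0) :
    ∀ e, a e = 0 := by
  induction q with
  | zero => simpa [Fin.forall_fin_one] using hsum
  | succ q ih =>
    set M := N - C (lam q) * P with hM
    have hM0 : M ≠ 0 := sub_C_mul_ne_zero hdeg _
    have hsplit : (∑ e : Fin (q + 1), a e.castSucc *
        (P ^ (e : ℕ) * ∏ k ∈ Finset.Ico (e : ℕ) q, (N - C (lam k) * P))) * M +
        a (Fin.last _) * P ^ (q + 1) = 0 := by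
      rw [Fin.sum_univ_castSucc] at hsum
      rw [← hsum, Finset.sum_mul]
      congr 1
      · refine Finset.sum_congr rfl fun e _ => ?_
        rw [Fin.val_castSucc, Finset.prod_Ico_succ_top (Nat.lt_succ_iff.mp e.2)]
        ring
      · simp
    have hlast : a (Fin.last _) = 0 := by
      have hdvd : M ∣ a (Fin.last _) * P ^ (q + 1) :=
        eq_neg_of_add_eq_zero_right hsplit ▸ (Dvd.intro_left _ rfl).neg_right
      refine eq_zero_of_dvd_of_degree_lt
        ((isCoprime_sub_C_mul hcop (lam q)).pow_right.dvd_of_dvd_mul_right hdvd) ?_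
      rw [degree_sub_eq_left_of_degree_lt ((degree_C_mul_le_degree _ P).trans_lt hdeg)]
      exact ha _
    rw [hlast, zero_mul, add_zero, mul_eq_zero, or_iff_left hM0] at hsplit
    exact fun e => Fin.lastCases hlast (ih _ (fun e => ha _) hsplit) e

/-- A product of terms `P i ^ e i * ∏ k ≥ e i, (N i - lam i k * P i)` along a chain. -/
noncomputable def chainProd {r : ℕ} (p : Fin r → ℕ) (N P : Fin r → F[X])
    (lam : Fin r → ℕ → F) (e : ∀ i, Fin (p i)) : F[X] :=
  ∏ i, (P i ^ (e i : ℕ) * ∏ k ∈ Finset.Ico (e i : ℕ) (p i - 1), (N i - C (lam i k) * P i))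

theorem natDegree_pow_mul_prod_le {N P : F[X]} {d : ℕ} (hN : N.natDegree ≤ d)
    (hP : P.natDegree ≤ d) (lam : ℕ → F) {e q : ℕ} (he : e ≤ q) :
    (P ^ e * ∏ k ∈ Finset.Ico e q, (N - C (lam k) * P)).natDegree ≤ q * d := by
  have h1 : (P ^ e).natDegree ≤ e * d :=
    natDegree_pow_le.trans (Nat.mul_le_mul_left _ hP)
  have h2 : (∏ k ∈ Finset.Ico e q, (N - C (lam k) * P)).natDegree ≤ (q - e) * d := by
    refine (natDegree_prod_le _ _).trans ((Finset.sum_le_card_nsmul _ _ d fun k _ => ?_).trans ?_)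
    · exact (natDegree_sub_le _ _).trans (max_le hN ((natDegree_C_mul_le _ _).trans hP))
    · simp
  refine natDegree_mul_le.trans ((add_le_add h1 h2).trans ?_)
  rw [← add_mul, Nat.add_sub_cancel' he]

theorem natDegree_chainProd_lt {r : ℕ} (p : Fin r → ℕ) (N P : Fin r → F[X])
    (lam : Fin r → ℕ → F) (d : Fin (r + 1) → ℕ) (hd0 : d 0 = 1)
    (hd : ∀ i : Fin r, d i.succ = p i * d i.castSucc)
    (hN : ∀ i, (N i).natDegree = d i.castSucc) (hP : ∀ i, (P i).degree < (N i).degree)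
    (e : ∀ i, Fin (p i)) : (chainProd p N P lam e).natDegree < d (Fin.last r) := by
  induction r with
  | zero => simp [chainProd, hd0]
  | succ r ih =>
    have h1 := ih (p ∘ Fin.castSucc) (N ∘ Fin.castSucc) (P ∘ Fin.castSucc) (lam ∘ Fin.castSucc)
      (d ∘ Fin.castSucc) hd0 (fun i => by simpa using hd i.castSucc) (fun i => hN _)
      (fun i => hP _) (fun i => e i.castSucc)
    have h2 := natDegree_pow_mul_prod_le (hN (Fin.last r)).le
      ((natDegree_le_natDegree (hP (Fin.last r)).le).trans (hN (Fin.last r)).le)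
      (lam (Fin.last r)) (Nat.le_sub_one_of_lt (e (Fin.last r)).2)
    have h3 := hd (Fin.last r)
    obtain ⟨q, hq⟩ := Nat.exists_eq_add_one_of_ne_zero (Nat.ne_zero_of_lt (e (Fin.last r)).2)
    rw [Fin.succ_last] at h3
    rw [h3, chainProd, Fin.prod_univ_castSucc]
    refine natDegree_mul_le.trans_lt ((add_lt_add_of_lt_of_le h1 h2).trans_eq ?_)
    rw [hq, Nat.add_sub_cancel, add_mul, one_mul, add_comm]
    rfl

theorem linearIndependent_chainProd {r : ℕ} (p : Fin r → ℕ) (N P : Fin r → F[X])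
    (lam : Fin r → ℕ → F) (d : Fin (r + 1) → ℕ) (hd0 : d 0 = 1)
    (hd : ∀ i : Fin r, d i.succ = p i * d i.castSucc)
    (hN : ∀ i, (N i).natDegree = d i.castSucc) (hP : ∀ i, (P i).degree < (N i).degree)
    (hcop : ∀ i, IsCoprime (N i) (P i)) :
    LinearIndependent F (chainProd p N P lam) := by
  induction r with
  | zero =>
    rw [linearIndependent_unique_iff]
    simp [chainProd]
  | succ r ih =>
    have hd' : ∀ i : Fin r, (d ∘ Fin.castSucc) i.succ =
        (p ∘ Fin.castSucc) i * (d ∘ Fin.castSucc) i.castSucc :=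
      fun i => by simpa using hd i.castSucc
    have hlin := ih (p ∘ Fin.castSucc) (N ∘ Fin.castSucc) (P ∘ Fin.castSucc)
      (lam ∘ Fin.castSucc) (d ∘ Fin.castSucc) hd0 hd' (fun i => hN _) (fun i => hP _)
      (fun i => hcop _)
    have hdeg := natDegree_chainProd_lt (p ∘ Fin.castSucc) (N ∘ Fin.castSucc) (P ∘ Fin.castSucc)
      (lam ∘ Fin.castSucc) (d ∘ Fin.castSucc) hd0 hd' (fun i => hN _) (fun i => hP _)
    rw [Fintype.linearIndependent_iff] at hlin ⊢
    intro c hc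
    rw [← (Fin.snocEquiv (fun i => Fin (p i))).sum_comp, Fintype.sum_prod_type] at hc
    have key : ∀ x : Fin (p (Fin.last r)), ∑ y : ∀ i : Fin r, Fin (p i.castSucc),
        c (Fin.snocEquiv (fun i => Fin (p i)) (x, y)) •
          chainProd (p ∘ Fin.castSucc) (N ∘ Fin.castSucc) (P ∘ Fin.castSucc)
            (lam ∘ Fin.castSucc) y = 0 := by
      have hstep : ∀ (m : ℕ) (a : Fin m → F[X]),
          (∀ e, (a e).degree < (N (Fin.last r)).degree) →
          ∑ e, a e * (P (Fin.last r) ^ (e : ℕ) * ∏ k ∈ Finset.Ico (e : ℕ) (m - 1),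
            (N (Fin.last r) - C (lam (Fin.last r) k) * P (Fin.last r))) = 0 → ∀ e, a e = 0 := by
        rintro (_ | q) a ha hsum
        · exact fun e => e.elim0
        · exact eq_zero_of_sum_mul_pow_mul_prod_eq_zero (hcop _) (hP _) _ q a ha hsum
      refine hstep (p (Fin.last r)) _ (fun x => ?_) (hc ▸ ?_)
      · have hN0 : N (Fin.last r) ≠ 0 := by
          rintro h0
          simpa [h0] using hP (Fin.last r)
        rw [degree_eq_natDegree hN0, hN, ← mem_degreeLT]
        refine Submodule.sum_mem _ fun y _ => Submodule.smul_mem _ _ ?_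
        rw [mem_degreeLT]
        exact degree_le_natDegree.trans_lt (by exact_mod_cast hdeg y)
      · refine Finset.sum_congr rfl fun x _ => ?_
        rw [Finset.sum_mul]
        refine Finset.sum_congr rfl fun y _ => ?_
        rw [smul_mul_assoc]
        congr 1
        simp [chainProd, Fin.prod_univ_castSucc, Fin.snocEquiv]
    intro e
    have := hlin _ (key (e (Fin.last r))) (fun i => e i.castSucc)
    rwa [show Fin.snocEquiv (fun i => Fin (p i)) (e (Fin.last r), fun i => e i.castSucc) = e from
      (Fin.snocEquiv (fun i => Fin (p i))).apply_symm_apply e] at this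

/-- The telescoped denominator of a chain is recovered from its factors. -/
theorem prod_prod_sub_eq_last {r : ℕ} (p : Fin r → ℕ) (N P : Fin (r + 1) → F[X])
    (lam : Fin r → ℕ → F) (hP0 : P 0 = 1)
    (hP : ∀ i : Fin r, P i.succ = P i.castSucc *
      ∏ k ∈ Finset.range (p i - 1), (N i.castSucc - C (lam i k) * P i.castSucc)) :
    ∏ i : Fin r, ∏ k ∈ Finset.range (p i - 1),
      (N i.castSucc - C (lam i k) * P i.castSucc) = P (Fin.last r) := by
  induction r with
  | zero => simp [hP0]
  | succ r ih =>
    rw [Fin.prod_univ_castSucc, ← Fin.succ_last, hP]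
    congr 1
    exact ih (p ∘ Fin.castSucc) (N ∘ Fin.castSucc) (P ∘ Fin.castSucc) (lam ∘ Fin.castSucc) hP0
      (fun i => by simpa using hP i.castSucc)

end PolynomialChain

section Moebius

variable {F : Type*} [Field F]

theorem ratFunc_algEquiv_eq_of_apply_X {σ τ : RatFunc F ≃ₐ[F] RatFunc F}
    (h : σ RatFunc.X = τ RatFunc.X) : σ = τ := by
  have hp : ∀ f : F[X], σ (algebraMap F[X] (RatFunc F) f) = τ (algebraMap F[X] (RatFunc F) f) := by
    intro f
    have : ((σ : RatFunc F →ₐ[F] RatFunc F).comp (IsScalarTower.toAlgHom F F[X] (RatFunc F))) =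
        ((τ : RatFunc F →ₐ[F] RatFunc F).comp (IsScalarTower.toAlgHom F F[X] (RatFunc F))) := by
      ext
      simpa [RatFunc.algebraMap_X] using h
    exact DFunLike.congr_fun this f
  ext f
  rw [← RatFunc.num_div_denom f, map_div₀, map_div₀, hp, hp]

theorem ratFunc_X_sub_C_ne_zero_s14 (s : F) : (RatFunc.X - RatFunc.C s : RatFunc F) ≠ 0 := by
  rw [← RatFunc.algebraMap_X, ← RatFunc.algebraMap_C, ← map_sub]
  exact RatFunc.algebraMap_ne_zero (X_sub_C_ne_zero s)

/-- The fractional linear function with pole `s` and value `-(s + A)` at infinity, attached to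
the quadratic `X ^ 2 + A X + B`. -/
noncomputable def moebius (A B s : F) : RatFunc F :=
  -RatFunc.C (s + A) - RatFunc.C (s ^ 2 + A * s + B) / (RatFunc.X - RatFunc.C s)

theorem pow_apply_X_eq_moebius {A B : F} (hAB : ∀ s : F, s ^ 2 + A * s + B ≠ 0)
    {σ : RatFunc F ≃ₐ[F] RatFunc F}
    (hσ : σ RatFunc.X = -RatFunc.C B / (RatFunc.X + RatFunc.C A)) (k : ℕ) :
    σ ^ k = 1 ∨ ∃ s, (σ ^ k) RatFunc.X = moebius A B s := by
  have hB : B ≠ 0 := by simpa using hAB 0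
  induction k with
  | zero => exact Or.inl (pow_zero σ)
  | succ k ih =>
    have hC (τ : RatFunc F ≃ₐ[F] RatFunc F) (c : F) : τ (RatFunc.C c) = RatFunc.C c := by
      rw [← RatFunc.algebraMap_eq_C, AlgEquiv.commutes]
    have hstep : (σ ^ (k + 1)) RatFunc.X =
        -RatFunc.C B / ((σ ^ k) RatFunc.X + RatFunc.C A) := by
      rw [pow_succ, AlgEquiv.mul_apply, hσ, map_div₀, map_neg, map_add, hC, hC]
    rcases ih with h | ⟨s, hs⟩
    · right
      refine ⟨-A, ?_⟩
      rw [hstep, h, moebius]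
      simp
      ring
    · have hXs := ratFunc_X_sub_C_ne_zero_s14 s
      by_cases h0 : s = 0
      · left
        apply ratFunc_algEquiv_eq_of_apply_X
        rw [hstep, hs, moebius, h0]
        have hB' : (RatFunc.C B : RatFunc F) ≠ 0 := by simpa using hB
        have hX := RatFunc.X_ne_zero (K := F)
        have hB'' : (-RatFunc.C A + -(RatFunc.C B / RatFunc.X) + RatFunc.C A : RatFunc F) =
            -(RatFunc.C B / RatFunc.X) := by ring
        simp only [map_zero, zero_add, sub_zero, ne_eq, OfNat.ofNat_ne_zero, not_false_eq_true,
          zero_pow, mul_zero, sub_eq_add_neg _ (RatFunc.C B / RatFunc.X), hB'', AlgEquiv.one_apply]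
        field_simp
      · right
        refine ⟨-(A + B / s), ?_⟩
        rw [hstep, hs, moebius, moebius]
        have hs' : (RatFunc.C s : RatFunc F) ≠ 0 := by simpa using h0
        have h2 : (RatFunc.C s * RatFunc.X + RatFunc.C A * RatFunc.C s + RatFunc.C B :
            RatFunc F) ≠ 0 := by
          have := ratFunc_X_sub_C_ne_zero_s14 (-(A + B / s))
          intro h
          apply this
          apply mul_left_cancel₀ hs'
          rw [mul_zero, ← h]
          simp only [map_neg, map_add, map_div₀]
          field_simp
          ring
        have h3 : (-RatFunc.C (s + A) - RatFunc.C (s ^ 2 + A * s + B) / (RatFunc.X - RatFunc.C s) +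
            RatFunc.C A : RatFunc F) = -(RatFunc.C s * RatFunc.X + RatFunc.C A * RatFunc.C s +
              RatFunc.C B) / (RatFunc.X - RatFunc.C s) := by
          simp only [map_add, map_mul, map_pow]
          field_simp
          ring
        have h4 : (RatFunc.X - RatFunc.C (-(A + B / s)) : RatFunc F) =
            (RatFunc.C s * RatFunc.X + RatFunc.C A * RatFunc.C s + RatFunc.C B) / RatFunc.C s := by
          simp only [map_neg, map_add, map_div₀]
          field_simp
          ring
        rw [h3, h4, div_div_eq_mul_div, div_eq_iff (neg_ne_zero.mpr h2), sub_mul,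
          div_div_eq_mul_div, mul_neg (_ / _), div_mul_cancel₀ _ h2]
        simp only [map_neg, map_add, map_div₀, map_mul, map_pow]
        field_simp
        ring

theorem quadratic_moebius (A B s : F) :
    moebius A B s ^ 2 + RatFunc.C A * moebius A B s + RatFunc.C B =
      RatFunc.C (s ^ 2 + A * s + B) * (RatFunc.X ^ 2 + RatFunc.C A * RatFunc.X + RatFunc.C B) /
        (RatFunc.X - RatFunc.C s) ^ 2 := by
  have hXs := ratFunc_X_sub_C_ne_zero_s14 s
  rw [moebius]
  simp only [map_add, map_mul, map_pow]
  field_simp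
  ring

/-- The poles of the nontrivial elements of a finite subgroup of `⟨σ⟩`. -/
theorem exists_finset_poles {A B : F} (hAB : ∀ s : F, s ^ 2 + A * s + B ≠ 0)
    {σ : RatFunc F ≃ₐ[F] RatFunc F} (hfin : IsOfFinOrder σ)
    (hσ : σ RatFunc.X = -RatFunc.C B / (RatFunc.X + RatFunc.C A))
    (H : Subgroup (RatFunc F ≃ₐ[F] RatFunc F)) [Fintype H] (hH : H ≤ Subgroup.zpowers σ)
    {Q : F[X]} (hQ : Q = X ^ 2 + C A * X + C B) :
    ∃ (S : Finset F) (c : F), S.card + 1 = Fintype.card H ∧ c ≠ 0 ∧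
      ∑ τ : H, (τ : RatFunc F ≃ₐ[F] RatFunc F) RatFunc.X =
        RatFunc.X + ∑ s ∈ S, moebius A B s ∧
      ∏ τ : H, (τ : RatFunc F ≃ₐ[F] RatFunc F) (1 / algebraMap F[X] (RatFunc F) Q) =
        RatFunc.C c * algebraMap F[X] (RatFunc F) (∏ s ∈ S, (X - C s)) ^ 2 /
          algebraMap F[X] (RatFunc F) (Q ^ Fintype.card H) := by
  classical
  have hex : ∀ τ : H, ∃ s : F, τ ≠ 1 →
      (τ : RatFunc F ≃ₐ[F] RatFunc F) RatFunc.X = moebius A B s := by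
    intro τ
    obtain ⟨k, hk⟩ := hfin.mem_powers_iff_mem_zpowers.mpr (hH τ.2)
    rcases pow_apply_X_eq_moebius hAB hσ k with h | ⟨s, hs⟩
    · exact ⟨0, fun h1 => (h1 (Subtype.ext (hk.symm.trans h))).elim⟩
    · exact ⟨s, fun _ => by rw [← hk]; exact hs⟩
  choose pole hpole using hex
  have hinj : Set.InjOn pole (Finset.univ.erase (1 : H) : Finset H) := by
    intro τ hτ τ' hτ' h
    apply Subtype.ext
    apply ratFunc_algEquiv_eq_of_apply_X
    rw [hpole τ (by simpa using hτ), hpole τ' (by simpa using hτ'), h]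
  have hQX (τ : RatFunc F ≃ₐ[F] RatFunc F) : τ (1 / algebraMap F[X] (RatFunc F) Q) =
      1 / (τ RatFunc.X ^ 2 + RatFunc.C A * τ RatFunc.X + RatFunc.C B) := by
    have hC (c : F) : τ (RatFunc.C c) = RatFunc.C c := by
      rw [← RatFunc.algebraMap_eq_C, AlgEquiv.commutes]
    simp [hQ, RatFunc.algebraMap_X, RatFunc.algebraMap_C, hC]
  have hQ' : algebraMap F[X] (RatFunc F) Q =
      RatFunc.X ^ 2 + RatFunc.C A * RatFunc.X + RatFunc.C B := by
    simp [hQ, RatFunc.algebraMap_X, RatFunc.algebraMap_C]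
  set S := (Finset.univ.erase (1 : H)).image pole with hS
  have hcard : S.card + 1 = Fintype.card H := by
    rw [hS, Finset.card_image_of_injOn hinj, Finset.card_erase_of_mem (Finset.mem_univ _),
      Finset.card_univ, Nat.sub_add_cancel Fintype.card_pos]
  refine ⟨S, ∏ s ∈ S, (s ^ 2 + A * s + B)⁻¹, hcard,
    Finset.prod_ne_zero_iff.mpr fun s _ => inv_ne_zero (hAB s), ?_, ?_⟩
  · rw [← Finset.add_sum_erase _ _ (Finset.mem_univ (1 : H)), hS, Finset.sum_image hinj]
    congr 1
    exact Finset.sum_congr rfl fun τ hτ => hpole τ (by simpa using hτ)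
  · rw [← Finset.mul_prod_erase _ _ (Finset.mem_univ (1 : H)), ← hcard, hS,
      Finset.prod_image hinj, Finset.prod_image hinj, Finset.card_image_of_injOn hinj]
    have hprod : ∏ τ ∈ Finset.univ.erase (1 : H),
        (τ : RatFunc F ≃ₐ[F] RatFunc F) (1 / algebraMap F[X] (RatFunc F) Q) =
        ∏ τ ∈ Finset.univ.erase (1 : H), (RatFunc.C (pole τ ^ 2 + A * pole τ + B)⁻¹ *
          algebraMap F[X] (RatFunc F) (X - C (pole τ)) ^ 2 / algebraMap F[X] (RatFunc F) Q) := by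
      refine Finset.prod_congr rfl fun τ hτ => ?_
      rw [hQX, hpole τ (by simpa using hτ), quadratic_moebius, hQ']
      simp [RatFunc.algebraMap_X, RatFunc.algebraMap_C, div_eq_mul_inv]
      ring
    rw [hprod, Finset.prod_div_distrib, Finset.prod_mul_distrib, Finset.prod_pow,
      Finset.prod_const, map_prod, map_prod, map_pow,
      pow_succ (algebraMap F[X] (RatFunc F) Q), mul_comm]
    exact (div_mul_div_comm _ _ _ _).trans (by rw [mul_one])

theorem exists_coprime_numerator {A B : F} (hAB : ∀ s : F, s ^ 2 + A * s + B ≠ 0)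
    (S : Finset F) :
    ∃ N : F[X], N.Monic ∧ N.natDegree = S.card + 1 ∧ IsCoprime N (∏ s ∈ S, (X - C s)) ∧
      (RatFunc.X + ∑ s ∈ S, moebius A B s : RatFunc F) =
        algebraMap F[X] (RatFunc F) N / algebraMap F[X] (RatFunc F) (∏ s ∈ S, (X - C s)) := by
  classical
  set P : F[X] := ∏ s ∈ S, (X - C s) with hP
  have hPm : P.Monic := monic_prod_of_monic _ _ fun s _ => monic_X_sub_C s
  have hPd : P.natDegree = S.card := by
    rw [hP, natDegree_prod_of_monic _ _ fun s _ => monic_X_sub_C s]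
    simp
  set c : F := ∑ s ∈ S, (s + A) with hc
  set R : F[X] := ∑ s ∈ S, C (s ^ 2 + A * s + B) * ∏ t ∈ S.erase s, (X - C t) with hR
  have hRd : R.degree < ((X - C c) * P).degree := by
    rw [degree_mul, degree_X_sub_C, degree_eq_natDegree hPm.ne_zero, hPd]
    refine (degree_sum_le _ _).trans_lt ((Finset.sup_lt_iff ?_).mpr fun s hs => ?_)
    · rw [← Nat.cast_one, ← Nat.cast_add]
      exact WithBot.bot_lt_coe _
    · refine (degree_C_mul_le_degree _ _).trans_lt ?_
      rw [degree_prod]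
      simp only [degree_X_sub_C, Finset.sum_const, Finset.card_erase_of_mem hs, nsmul_one]
      exact_mod_cast (by omega : S.card - 1 < 1 + S.card)
  have hm : ((X - C c) * P).Monic := (monic_X_sub_C c).mul hPm
  refine ⟨(X - C c) * P - R, hm.sub_of_left hRd, ?_, ?_, ?_⟩
  · rw [natDegree_eq_of_degree_eq (degree_sub_eq_left_of_degree_lt hRd),
      (monic_X_sub_C c).natDegree_mul hPm, hPd, natDegree_X_sub_C, add_comm]
  · refine IsCoprime.prod_right fun s hs => IsCoprime.symm ?_
    rw [(irreducible_X_sub_C s).coprime_iff_not_dvd, dvd_iff_isRoot, IsRoot.def]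
    have h1 : P.eval s = 0 := by
      rw [hP, eval_prod]
      exact Finset.prod_eq_zero hs (by simp)
    have h2 : R.eval s = (s ^ 2 + A * s + B) * ∏ t ∈ S.erase s, (s - t) := by
      rw [hR, eval_finsetSum, Finset.sum_eq_single_of_mem s hs]
      · simp [eval_prod]
      · intro t ht hts
        rw [eval_mul, eval_prod, Finset.prod_eq_zero (Finset.mem_erase.mpr ⟨hts.symm, hs⟩)]
        · simp
        · simp
    rw [eval_sub, eval_mul, h1, h2, mul_zero, zero_sub, neg_eq_zero]
    exact mul_ne_zero (hAB s) (Finset.prod_ne_zero_iff.mpr fun t ht =>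
      sub_ne_zero.mpr (Finset.ne_of_mem_erase ht).symm)
  · have hP0 : algebraMap F[X] (RatFunc F) P ≠ 0 := RatFunc.algebraMap_ne_zero hPm.ne_zero
    rw [eq_div_iff hP0, add_mul, Finset.sum_mul, map_sub, map_mul]
    simp only [hR, hc]
    simp only [map_sub, RatFunc.algebraMap_X, RatFunc.algebraMap_C, map_sum, map_mul]
    rw [sub_mul, sub_sub, sub_eq_add_neg]
    congr 1
    rw [Finset.sum_mul, ← Finset.sum_add_distrib, ← Finset.sum_neg_distrib]
    refine Finset.sum_congr rfl fun s hs => ?_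
    have hXs := ratFunc_X_sub_C_ne_zero_s14 s
    have : algebraMap F[X] (RatFunc F) P = (RatFunc.X - RatFunc.C s) *
        algebraMap F[X] (RatFunc F) (∏ t ∈ S.erase s, (X - C t)) := by
      rw [hP, ← Finset.mul_prod_erase _ _ hs, map_mul, map_sub, RatFunc.algebraMap_X,
        RatFunc.algebraMap_C]
    rw [this, moebius]
    simp only [map_add, map_mul, map_pow]
    field_simp
    ring

end Moebius

section Assembly

variable {F : Type*} [Field F]

theorem exists_aeval_div_eq (N P : F[X]) (hP : P ≠ 0) (u : F[X]) {p : ℕ} (hu : u.natDegree ≤ p) :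
    ∃ U : F[X], aeval (algebraMap F[X] (RatFunc F) N / algebraMap F[X] (RatFunc F) P) u =
      algebraMap F[X] (RatFunc F) U / algebraMap F[X] (RatFunc F) P ^ p := by
  have hP' := RatFunc.algebraMap_ne_zero hP
  refine ⟨∑ j ∈ Finset.range (p + 1), C (u.coeff j) * (N ^ j * P ^ (p - j)), ?_⟩
  rw [aeval_eq_sum_range' (Nat.lt_succ_of_le hu), map_sum, Finset.sum_div]
  refine Finset.sum_congr rfl fun j hj => ?_
  have hj' : j ≤ p := Nat.lt_succ_iff.mp (Finset.mem_range.mp hj)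
  rw [RatFunc.smul_eq_C_mul, map_mul, map_mul, map_pow, map_pow, RatFunc.algebraMap_C, div_pow,
    mul_div_assoc]
  congr 1
  rw [div_eq_div_iff (pow_ne_zero _ hP') (pow_ne_zero _ hP'), mul_assoc, ← pow_add,
    Nat.sub_add_cancel hj']

theorem div_sub_C_eq {N P : F[X]} (hP : P ≠ 0) (c : F) :
    algebraMap F[X] (RatFunc F) N / algebraMap F[X] (RatFunc F) P - RatFunc.C c =
      algebraMap F[X] (RatFunc F) (N - C c * P) / algebraMap F[X] (RatFunc F) P := by
  have hP' := RatFunc.algebraMap_ne_zero hP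
  rw [map_sub, map_mul, RatFunc.algebraMap_C, sub_div, mul_div_cancel_right₀ _ hP']

theorem prod_div_sub_C_eq {N P : F[X]} (hP : P ≠ 0) (lam : ℕ → F) (q : ℕ) :
    ∏ k ∈ Finset.range q, (algebraMap F[X] (RatFunc F) N / algebraMap F[X] (RatFunc F) P -
      RatFunc.C (lam k)) = algebraMap F[X] (RatFunc F) (∏ k ∈ Finset.range q, (N - C (lam k) * P)) /
        algebraMap F[X] (RatFunc F) P ^ q := by
  simp only [div_sub_C_eq hP, Finset.prod_div_distrib, Finset.prod_const, Finset.card_range,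
    map_prod]

/-- The reduced denominator of `u(N / P) / ∏ (N / P - lam k)`. -/
theorem denominator_eq_mul_prod {N P N' P' u : F[X]} {p : ℕ} (hp : 0 < p) (lam : ℕ → F)
    (hN : N.Monic) (hP : P.Monic) (hP' : P'.Monic) (hcop : IsCoprime N' P')
    (hNP : N.natDegree = P.natDegree + 1) (hdeg : P'.natDegree + 1 = p * N.natDegree)
    (hu : u.natDegree ≤ p)
    (hrec : algebraMap F[X] (RatFunc F) N' / algebraMap F[X] (RatFunc F) P' =
      aeval (algebraMap F[X] (RatFunc F) N / algebraMap F[X] (RatFunc F) P) u /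
        ∏ k ∈ Finset.range (p - 1),
          (algebraMap F[X] (RatFunc F) N / algebraMap F[X] (RatFunc F) P - RatFunc.C (lam k))) :
    P' = P * ∏ k ∈ Finset.range (p - 1), (N - C (lam k) * P) := by
  obtain ⟨q, rfl⟩ := Nat.exists_eq_add_one_of_ne_zero hp.ne'
  rw [Nat.add_sub_cancel] at *
  have hlt : P.degree < N.degree := degree_lt_degree (by omega)
  have hm : ∀ k, (N - C (lam k) * P).Monic := fun k =>
    hN.sub_of_left ((degree_C_mul_le_degree _ P).trans_lt hlt)
  have hM : (∏ k ∈ Finset.range q, (N - C (lam k) * P)).Monic :=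
    monic_prod_of_monic _ _ fun k _ => hm k
  obtain ⟨U, hU⟩ := exists_aeval_div_eq N P hP.ne_zero u hu
  have h0 := RatFunc.algebraMap_ne_zero (K := F) hP.ne_zero
  have h1 := RatFunc.algebraMap_ne_zero (K := F) hP'.ne_zero
  have h2 := RatFunc.algebraMap_ne_zero (K := F) hM.ne_zero
  have hmul : N' * (P * ∏ k ∈ Finset.range q, (N - C (lam k) * P)) = U * P' := by
    apply RatFunc.algebraMap_injective F
    rw [map_mul, map_mul, map_mul]
    rw [hU, prod_div_sub_C_eq hP.ne_zero, pow_succ] at hrec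
    generalize algebraMap F[X] (RatFunc F) (∏ k ∈ Finset.range q, (N - C (lam k) * P)) = M at *
    field_simp at hrec
    linear_combination hrec
  refine (eq_of_monic_of_dvd_of_natDegree_le hP' (hP.mul hM)
    (hcop.symm.dvd_of_dvd_mul_left ⟨U, by rw [hmul, mul_comm]⟩) ?_).symm
  rw [hP.natDegree_mul hM, natDegree_prod_of_monic _ _ fun k _ => hm k]
  simp only [natDegree_sub_C_mul hlt, Finset.sum_const, Finset.card_range, smul_eq_mul]
  rw [add_mul] at hdeg
  omega

theorem last_eq_prod_of_succ_eq_mul {r : ℕ} (p : Fin r → ℕ) (d : Fin (r + 1) → ℕ) (hd0 : d 0 = 1)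
    (hd : ∀ i : Fin r, d i.succ = p i * d i.castSucc) : d (Fin.last r) = ∏ i, p i := by
  induction r with
  | zero => simpa using hd0
  | succ r ih =>
    rw [← Fin.succ_last, hd, Fin.prod_univ_castSucc, mul_comm]
    congr 1
    exact ih (p ∘ Fin.castSucc) (d ∘ Fin.castSucc) hd0 fun i => by simpa using hd i.castSucc

theorem prod_inv_mul_eq_chainProd {r : ℕ} (p : Fin r → ℕ) (N P : Fin r → F[X])
    (lam : Fin r → ℕ → F) (hP0 : ∀ i, P i ≠ 0) (hP : ∀ i, (P i).degree < (N i).degree)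
    (e : ∀ i, Fin (p i)) :
    (∏ i, (∏ k ∈ Finset.range (e i : ℕ), (algebraMap F[X] (RatFunc F) (N i) /
        algebraMap F[X] (RatFunc F) (P i) - RatFunc.C (lam i k)))⁻¹) *
      algebraMap F[X] (RatFunc F)
        (∏ i, ∏ k ∈ Finset.range (p i - 1), (N i - C (lam i k) * P i)) =
      algebraMap F[X] (RatFunc F) (chainProd p N P lam e) := by
  rw [chainProd, map_prod, map_prod, ← Finset.prod_mul_distrib]
  refine Finset.prod_congr rfl fun i _ => ?_
  rw [prod_div_sub_C_eq (hP0 i), ← Finset.prod_range_mul_prod_Ico _ (Nat.le_sub_one_of_lt (e i).2),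
    map_mul, map_mul, map_pow, inv_div]
  have h : algebraMap F[X] (RatFunc F)
      (∏ k ∈ Finset.range (e i : ℕ), (N i - C (lam i k) * P i)) ≠ 0 :=
    RatFunc.algebraMap_ne_zero (Finset.prod_ne_zero_iff.mpr fun k _ => sub_C_mul_ne_zero (hP i) _)
  rw [← mul_assoc, div_mul_cancel₀ _ h]

theorem span_range_eq_degreeLT {ι : Type*} [Fintype ι] {n : ℕ} {f : ι → F[X]}
    (hf : LinearIndependent F f) (hdeg : ∀ i, (f i).natDegree < n) (hcard : Fintype.card ι = n) :
    Submodule.span F (Set.range f) = degreeLT F n := by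
  have : FiniteDimensional F (degreeLT F n) := (degreeLTEquiv F n).symm.finiteDimensional
  refine Submodule.eq_of_le_of_finrank_eq (Submodule.span_le.mpr ?_) ?_
  · rintro _ ⟨i, rfl⟩
    rw [SetLike.mem_coe, mem_degreeLT]
    exact degree_le_natDegree.trans_lt (by exact_mod_cast hdeg i)
  · rw [finrank_span_eq_card hf, (degreeLTEquiv F n).finrank_eq, hcard, Module.finrank_fin_fun]

theorem quadratic_ne_zero_of_irreducible {a b : F} (h : Irreducible (X ^ 2 + C a * X + C b : F[X])) :
    b ≠ 0 ∧ ∀ s : F, s ^ 2 + a / b * s + 1 / b ≠ 0 := by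
  have hroot : ∀ t : F, t ^ 2 + a * t + b ≠ 0 := by
    intro t ht
    have hd : (X ^ 2 + C a * X + C b : F[X]).degree = 2 := by
      have := degree_quadratic (a := (1 : F)) (b := a) (c := b) one_ne_zero
      simpa using this
    have h1 := degree_eq_one_of_irreducible_of_root h (x := t) (by simpa [IsRoot.def] using ht)
    rw [hd] at h1
    exact absurd h1 (by decide)
  have hb : b ≠ 0 := by simpa using hroot 0
  refine ⟨hb, fun s hs => ?_⟩
  have hs0 : s ≠ 0 := by
    rintro rfl
    simp [hb] at hs
  apply hroot s⁻¹
  field_simp at hs ⊢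
  linear_combination hs

end Assembly

/-- **A basis of `(u_{r,0}(x)/Q(x)^n)·𝔽_q[x]_{<n}` from a chain of subgroups of `⟨σ⟩`.**
Let `n = p_1 ⋯ p_r` divide `q+1` and let `⊥ = G_0 < G_1 < ⋯ < G_r` be a chain of
subgroups of `⟨σ⟩` with `|G_i| = p_1⋯p_i`.  With `x_i = Σ_{τ∈G_i} τ(x)`,
`y_r = ∏_{τ∈G_r} τ(1/Q(x))`, the recursions
`x_i = u_i(x_{i-1})/∏_k (x_{i-1} - λ_{i,k})` and
`x_r = u_{r,0}(x)/∏_j (x - α_j)` with `deg u_{r,0} = n`, the family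
`B̃ = {z_0^{(e_0)} ⋯ z_{r-1}^{(e_{r-1})}·x_r·y_r}` is an `𝔽_q`-basis of the subspace
`{u_{r,0}(x)·g(x)/Q(x)^n : deg g < n}` of `𝔽_q(x)` (equivalently,
`(Q^n/u_{r,0})·B̃` is a basis of `𝔽_q[x]_{<n}`). -/
theorem basis_of_scaled_polynomial_space
    (Fq : Type*) [Field Fq] [Fintype Fq] (a b : Fq)
    (m : Polynomial Fq) (hm : m = X ^ 2 + C a * X + C b)
    (hirr : Irreducible m)
    (hprim : orderOf (AdjoinRoot.root m) = Fintype.card Fq ^ 2 - 1)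
    (σ : RatFunc Fq ≃ₐ[Fq] RatFunc Fq)
    (hσ : σ RatFunc.X = 1 / (-(RatFunc.C b) * RatFunc.X - RatFunc.C a))
    (horder : orderOf σ = Fintype.card Fq + 1)
    (Qp : Polynomial Fq) (hQ : Qp = X ^ 2 + C (a / b) * X + C (1 / b))
    (r n : ℕ) (p : Fin r → ℕ)
    (hn : n = ∏ i, p i) (hdvd : n ∣ Fintype.card Fq + 1)
    (G : Fin (r + 1) → Subgroup (RatFunc Fq ≃ₐ[Fq] RatFunc Fq))
    [∀ i, Fintype (G i)]
    (hG0 : G 0 = ⊥)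
    (hGle : ∀ i, G i ≤ Subgroup.zpowers σ)
    (hchain : ∀ i : Fin r, G i.castSucc < G i.succ)
    (hcard : ∀ i : Fin r,
      Fintype.card (G i.succ) = p i * Fintype.card (G i.castSucc))
    (xi : Fin (r + 1) → RatFunc Fq)
    (hxi : ∀ i, xi i = ∑ τ : G i, (τ : RatFunc Fq ≃ₐ[Fq] RatFunc Fq) RatFunc.X)
    (yr : RatFunc Fq)
    (hyr : yr = ∏ τ : G (Fin.last r), (τ : RatFunc Fq ≃ₐ[Fq] RatFunc Fq)
      (1 / algebraMap (Polynomial Fq) (RatFunc Fq) Qp))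
    (lam : Fin r → ℕ → Fq) (u : Fin r → Polynomial Fq)
    (hlam : ∀ i : Fin r, ∀ k l : ℕ, k < p i - 1 → l < p i - 1 →
      lam i k = lam i l → k = l)
    (hu : ∀ i : Fin r, (u i).natDegree = p i)
    (hrec : ∀ i : Fin r, xi i.succ =
      Polynomial.aeval (xi i.castSucc) (u i) /
        ∏ k ∈ Finset.range (p i - 1), (xi i.castSucc - RatFunc.C (lam i k)))
    (u0 : Polynomial Fq) (alpha : Fin (n - 1) → Fq)
    (halpha : Function.Injective alpha) (hu0 : u0.natDegree = n)
    (hxr : xi (Fin.last r) =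
      algebraMap (Polynomial Fq) (RatFunc Fq) u0 /
        algebraMap (Polynomial Fq) (RatFunc Fq) (∏ j, (X - C (alpha j)))) :
    LinearIndependent Fq
      (fun e : (∀ i : Fin r, Fin (p i)) =>
        (∏ i : Fin r,
          (∏ k ∈ Finset.range (e i : ℕ),
            (xi i.castSucc - RatFunc.C (lam i k)))⁻¹) *
        xi (Fin.last r) * yr) ∧
    (Submodule.span Fq (Set.range
      (fun e : (∀ i : Fin r, Fin (p i)) =>
        (∏ i : Fin r,
          (∏ k ∈ Finset.range (e i : ℕ),
            (xi i.castSucc - RatFunc.C (lam i k)))⁻¹) *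
        xi (Fin.last r) * yr)) : Set (RatFunc Fq)) =
      {w : RatFunc Fq | ∃ g : Polynomial Fq, g.natDegree < n ∧
        w = algebraMap (Polynomial Fq) (RatFunc Fq) (u0 * g) /
          algebraMap (Polynomial Fq) (RatFunc Fq) (Qp ^ n)} := by
  classical
  subst hm
  obtain ⟨hb, hAB⟩ := quadratic_ne_zero_of_irreducible hirr
  have hσ' : σ RatFunc.X = -RatFunc.C (1 / b) / (RatFunc.X + RatFunc.C (a / b)) := by
    have h1 : (RatFunc.X + RatFunc.C (a / b) : RatFunc Fq) ≠ 0 := by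
      simpa using ratFunc_X_sub_C_ne_zero_s14 (-(a / b))
    have hb' : (RatFunc.C b : RatFunc Fq) ≠ 0 := by simpa using hb
    have h2 : (-(RatFunc.C b) * RatFunc.X - RatFunc.C a : RatFunc Fq) =
        -RatFunc.C b * (RatFunc.X + RatFunc.C (a / b)) := by
      rw [map_div₀]
      field_simp
      ring
    rw [hσ, h2, ← div_div, map_div₀ RatFunc.C 1, map_one, one_div_neg_eq_neg_one_div]
  have hfin : IsOfFinOrder σ := orderOf_pos_iff.mp (horder ▸ Nat.succ_pos _)
  choose S c hScard hc hsum hprod using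
    fun i => exists_finset_poles hAB hfin hσ' (G i) (hGle i) hQ
  choose N hNm hNd hcop hN using fun i => exists_coprime_numerator hAB (S i)
  set P : Fin (r + 1) → Fq[X] := fun i => ∏ s ∈ S i, (X - C s) with hPdef
  have hPm : ∀ i, (P i).Monic := fun i => monic_prod_of_monic _ _ fun s _ => monic_X_sub_C s
  have hPd : ∀ i, (P i).natDegree = (S i).card := by
    intro i
    rw [hPdef, natDegree_prod_of_monic _ _ fun s _ => monic_X_sub_C s]
    simp
  have hx : ∀ i, xi i = algebraMap Fq[X] (RatFunc Fq) (N i) /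
      algebraMap Fq[X] (RatFunc Fq) (P i) := fun i => by rw [hxi, hsum, hN]
  have hNcard : ∀ i, (N i).natDegree = Fintype.card (G i) := fun i => by rw [hNd, hScard]
  have hPN : ∀ i, (P i).degree < (N i).degree := fun i =>
    degree_lt_degree (by rw [hPd, hNd]; exact Nat.lt_succ_self _)
  have hd0 : Fintype.card (G 0) = 1 := by
    rw [Fintype.card_eq_nat_card, hG0, Subgroup.card_bot]
  have hp : ∀ i, 0 < p i := fun i => Nat.pos_of_ne_zero fun h => by
    have := hcard i
    rw [h, zero_mul] at this
    exact Fintype.card_ne_zero this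
  have hlast : Fintype.card (G (Fin.last r)) = n := by
    rw [hn]
    exact last_eq_prod_of_succ_eq_mul p (fun i => Fintype.card (G i)) hd0 hcard
  have hP0 : P 0 = 1 := by
    have : S 0 = ∅ := Finset.card_eq_zero.mp (by have := hScard 0; omega)
    simp [hPdef, this]
  have hPsucc : ∀ i : Fin r, P i.succ = P i.castSucc *
      ∏ k ∈ Finset.range (p i - 1), (N i.castSucc - C (lam i k) * P i.castSucc) := by
    intro i
    refine denominator_eq_mul_prod (hp i) (lam i) (hNm _) (hPm _) (hPm _) (hcop _) ?_ ?_ (hu i).le ?_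
    · rw [hNd, hPd]
    · rw [hPd, hScard, hNcard, hcard]
    · rw [← hx, ← hx, hrec]
  have hPlast := prod_prod_sub_eq_last p N P lam hP0 hPsucc
  have hαm : (∏ j, (X - C (alpha j))).Monic := monic_prod_of_monic _ _ fun j _ => monic_X_sub_C _
  have hα0 := RatFunc.algebraMap_ne_zero (K := Fq) hαm.ne_zero
  have hPl0 := RatFunc.algebraMap_ne_zero (K := Fq) (hPm (Fin.last r)).ne_zero
  have hcross : N (Fin.last r) * ∏ j, (X - C (alpha j)) = u0 * P (Fin.last r) := by
    apply RatFunc.algebraMap_injective Fq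
    rw [map_mul, map_mul, ← div_eq_div_iff hPl0 hα0, ← hx, hxr]
  have hα : ∏ j, (X - C (alpha j)) = P (Fin.last r) := by
    refine eq_of_monic_of_dvd_of_natDegree_le (hPm _) hαm
      ((hcop (Fin.last r)).symm.dvd_of_dvd_mul_left ⟨u0, by rw [hcross, mul_comm]⟩) ?_
    rw [natDegree_prod_of_monic _ _ fun j _ => monic_X_sub_C _, hPd]
    have := hScard (Fin.last r)
    simp
    omega
  have hu0N : u0 = N (Fin.last r) := by
    rw [hα] at hcross
    exact (mul_right_cancel₀ (hPm _).ne_zero hcross).symm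
  set d : Fin (r + 1) → ℕ := fun i => Fintype.card (G i) with hd
  have hlin := linearIndependent_chainProd p (fun i => N i.castSucc) (fun i => P i.castSucc) lam d
    hd0 hcard (fun i => hNcard _) (fun i => hPN _) (fun i => hcop _)
  have hdeg := natDegree_chainProd_lt p (fun i => N i.castSucc) (fun i => P i.castSucc) lam d
    hd0 hcard (fun i => hNcard _) (fun i => hPN _)
  have hspan := span_range_eq_degreeLT hlin (n := n) (fun e => hlast ▸ hdeg e) (by simp [hn])
  have hQ0 : Qp ≠ 0 := by
    rintro h
    have := hAB 0
    apply this
    have h' := congrArg (eval 0) (hQ.symm.trans h)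
    simpa using h'
  have hu00 : u0 ≠ 0 := hu0N ▸ (hNm _).ne_zero
  set κ : RatFunc Fq := RatFunc.C (c (Fin.last r)) * algebraMap Fq[X] (RatFunc Fq) u0 /
    algebraMap Fq[X] (RatFunc Fq) (Qp ^ n) with hκ
  have hκ0 : κ ≠ 0 := div_ne_zero (mul_ne_zero (by simpa using hc _)
    (RatFunc.algebraMap_ne_zero hu00)) (RatFunc.algebraMap_ne_zero (pow_ne_zero _ hQ0))
  set L : Fq[X] →ₗ[Fq] RatFunc Fq := LinearMap.mulLeft Fq κ ∘ₗ
    (IsScalarTower.toAlgHom Fq Fq[X] (RatFunc Fq)).toLinearMap with hL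
  have hLapply : ∀ g, L g = κ * algebraMap Fq[X] (RatFunc Fq) g := fun g => rfl
  have hLinj : Function.Injective L := fun f g h =>
    RatFunc.algebraMap_injective Fq (mul_left_cancel₀ hκ0 h)
  have hfamily : (fun e : (∀ i : Fin r, Fin (p i)) =>
        (∏ i : Fin r,
          (∏ k ∈ Finset.range (e i : ℕ),
            (xi i.castSucc - RatFunc.C (lam i k)))⁻¹) *
        xi (Fin.last r) * yr) =
      L ∘ chainProd p (fun i => N i.castSucc) (fun i => P i.castSucc) lam := by
    funext e
    rw [Function.comp_apply, hLapply, ← prod_inv_mul_eq_chainProd p _ _ lam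
      (fun i => (hPm _).ne_zero) (fun i => hPN _), hPlast, hyr, hprod, hlast, hx (Fin.last r), hκ,
      hu0N]
    simp only [hx]
    change _ * _ * (_ * algebraMap Fq[X] (RatFunc Fq) (P (Fin.last r)) ^ 2 / _) = _
    generalize (∏ i : Fin r, (_ : RatFunc Fq)) = Z
    field_simp
  rw [hfamily]
  refine ⟨hlin.map' L (LinearMap.ker_eq_bot.mpr hLinj), ?_⟩
  rw [Set.range_comp, Submodule.span_image, hspan]
  have hn0 : n ≠ 0 := hlast ▸ Fintype.card_ne_zero
  have hc0 := hc (Fin.last r)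
  ext w
  simp only [SetLike.mem_coe, Submodule.mem_map, Set.mem_ofPred_eq]
  constructor
  · rintro ⟨g, hg, rfl⟩
    refine ⟨C (c (Fin.last r)) * g, ?_, ?_⟩
    · rw [natDegree_C_mul hc0]
      rcases eq_or_ne g 0 with rfl | hg0
      · simpa using Nat.pos_of_ne_zero hn0
      · exact (natDegree_lt_iff_degree_lt hg0).mpr (mem_degreeLT.mp hg)
    · rw [hLapply, hκ, map_mul, map_mul, RatFunc.algebraMap_C]
      ring
  · rintro ⟨g, hg, rfl⟩
    refine ⟨C (c (Fin.last r))⁻¹ * g, ?_, ?_⟩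
    · rw [mem_degreeLT]
      refine (degree_C_mul_le_degree _ g).trans_lt (degree_le_natDegree.trans_lt ?_)
      exact_mod_cast hg
    · have hc' : (RatFunc.C (c (Fin.last r)) : RatFunc Fq) ≠ 0 := by simpa using hc0
      rw [hLapply, hκ, map_mul, map_mul, RatFunc.algebraMap_C, map_inv₀]
      field_simp
end
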